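/- arXiv:1306.2886 — 3 statements merged into one kernel-verified Lean document; each statement's English description precedes it below -/
import Mathlib

section
/- For every natural number k ≥ 1 and every δ > 0 there exists N_0 such that for all N ≥ N_0, every subset A of [N] := {n ∈ ℤ : 1 ≤ n ≤ N} with cardinality |A| ≥ δN contains an arithmetic progression a, a+r, …, a+(k−1)r of length k, where a ∈ ℤ and r is a positive integer. -/
open Finset Function Combinatorics
open scoped BigOperators

namespace Combinatorics.Subspace

variable {η β ι κ : Type*}

/-- The composition of two combinatorial subspaces. -/
def comp (V : Subspace κ β ι) (W : Subspace η β κ) : Subspace η β ι where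
  idxFun i := (V.idxFun i).elim Sum.inl W.idxFun
  proper e := by
    obtain ⟨j, hj⟩ := W.proper e
    obtain ⟨i, hi⟩ := V.proper j
    exact ⟨i, by simp [hi, hj]⟩

@[simp] lemma comp_apply (V : Subspace κ β ι) (W : Subspace η β κ) (x : η → β) :
    V.comp W x = V (W x) := by
  ext i
  cases h : V.idxFun i <;> simp [comp, coe_apply, h]

/-- The composition of a combinatorial subspace and a combinatorial line. -/
def compLine (V : Subspace κ β ι) (l : Line β κ) : Line β ι where
  idxFun i := (V.idxFun i).elim some l.idxFun
  proper := by
    obtain ⟨j, hj⟩ := l.proper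
    obtain ⟨i, hi⟩ := V.proper j
    exact ⟨i, by simp [hi, hj]⟩

lemma compLine_apply (V : Subspace κ β ι) (l : Line β κ) (b : β) :
    V.compLine l b = V (l b) := by
  ext i
  cases h : V.idxFun i <;> simp [compLine, coe_apply, h]

lemma injective (V : Subspace κ β ι) : Injective (V : (κ → β) → ι → β) := by
  intro x y h
  ext e
  obtain ⟨i, hi⟩ := V.proper e
  have := congrFun h i
  rwa [apply_inr hi, apply_inr hi] at this

instance [Finite β] [Finite ι] [Finite κ] : Finite (Subspace κ β ι) :=
  Finite.of_injective Subspace.idxFun fun _ _ h ↦ Subspace.ext h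

end Combinatorics.Subspace

instance {β ι : Type*} [Finite β] [Finite ι] : Finite (Line β ι) :=
  Finite.of_injective Line.idxFun fun _ _ h ↦ Line.ext h

namespace DensityHalesJewett

section Join

variable {β ι ι₁ ι₂ : Type*}

/-- Glue two words along a splitting of the coordinates. -/
def join (e : ι₁ ⊕ ι₂ ≃ ι) (x : ι₁ → β) (y : ι₂ → β) (i : ι) : β :=
  Sum.elim x y (e.symm i)

@[simp] lemma join_inl (e : ι₁ ⊕ ι₂ ≃ ι) (x : ι₁ → β) (y : ι₂ → β) (i : ι₁) :
    join e x y (e (Sum.inl i)) = x i := by simp [join]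

@[simp] lemma join_inr (e : ι₁ ⊕ ι₂ ≃ ι) (x : ι₁ → β) (y : ι₂ → β) (i : ι₂) :
    join e x y (e (Sum.inr i)) = y i := by simp [join]

lemma funext_join (e : ι₁ ⊕ ι₂ ≃ ι) {f g : ι → β} (h₁ : ∀ i, f (e (Sum.inl i)) = g (e (Sum.inl i)))
    (h₂ : ∀ i, f (e (Sum.inr i)) = g (e (Sum.inr i))) : f = g := by
  ext i
  obtain ⟨j | j, rfl⟩ := e.surjective i
  exacts [h₁ j, h₂ j]

/-- The subspace obtained by fixing the second group of coordinates. -/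
def fixRight (e : ι₁ ⊕ ι₂ ≃ ι) (y : ι₂ → β) : Subspace ι₁ β ι where
  idxFun i := (e.symm i).elim Sum.inr (Sum.inl ∘ y)
  proper j := ⟨e (Sum.inl j), by simp⟩

@[simp] lemma fixRight_apply (e : ι₁ ⊕ ι₂ ≃ ι) (y : ι₂ → β) (x : ι₁ → β) :
    fixRight e y x = join e x y := by
  refine funext_join e (fun i ↦ ?_) (fun i ↦ ?_) <;> simp [fixRight, Subspace.coe_apply]

/-- The subspace obtained by fixing the first group of coordinates. -/
def fixLeft (e : ι₁ ⊕ ι₂ ≃ ι) (x : ι₁ → β) : Subspace ι₂ β ι where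
  idxFun i := (e.symm i).elim (Sum.inl ∘ x) Sum.inr
  proper j := ⟨e (Sum.inr j), by simp⟩

@[simp] lemma fixLeft_apply (e : ι₁ ⊕ ι₂ ≃ ι) (x : ι₁ → β) (y : ι₂ → β) :
    fixLeft e x y = join e x y := by
  refine funext_join e (fun i ↦ ?_) (fun i ↦ ?_) <;> simp [fixLeft, Subspace.coe_apply]

lemma expect_join [Fintype ι] [DecidableEq ι] [Fintype ι₁] [DecidableEq ι₁] [Fintype ι₂]
    [DecidableEq ι₂] [Fintype β] (e : ι₁ ⊕ ι₂ ≃ ι) (F : (ι → β) → ℝ) :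
    𝔼 x : ι₁ → β, 𝔼 y : ι₂ → β, F (join e x y) = 𝔼 z, F z := by
  rw [← Finset.expect_product' (s := univ) (t := univ) (f := fun x y ↦ F (join e x y))]
  exact Fintype.expect_equiv
    ((Equiv.sumArrowEquivProdArrow ι₁ ι₂ β).symm.trans (e.arrowCongr (Equiv.refl β)))
    (fun p : (ι₁ → β) × (ι₂ → β) ↦ F (join e p.1 p.2)) F (fun _ ↦ rfl)

/-- A finite type with at least `n` elements splits off `n` of them. -/
lemma exists_splitting (ι : Type) [Fintype ι] {n : ℕ} (h : n ≤ Fintype.card ι) (κ : Type)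
    [Fintype κ] (hκ : Fintype.card κ = n) :
    Nonempty (κ ⊕ Fin (Fintype.card ι - n) ≃ ι) :=
  ⟨Fintype.equivOfCardEq (by simp; omega)⟩

end Join

section Expect

/-- The indicator of a proposition. -/
noncomputable def iverson (p : Prop) : ℝ := open Classical in if p then 1 else 0

lemma iverson_of {p : Prop} (h : p) : iverson p = 1 := if_pos h
lemma iverson_of_not {p : Prop} (h : ¬p) : iverson p = 0 := if_neg h

lemma iverson_nonneg (p : Prop) : 0 ≤ iverson p := by
  by_cases h : p <;> simp [iverson, h]

lemma iverson_le_one (p : Prop) : iverson p ≤ 1 := by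
  by_cases h : p <;> simp [iverson, h]

lemma iverson_and (p q : Prop) : iverson (p ∧ q) = iverson p * iverson q := by
  by_cases h : p <;> by_cases h' : q <;> simp [iverson, h, h']

lemma iverson_not (p : Prop) : iverson (¬p) = 1 - iverson p := by
  by_cases h : p <;> simp [iverson, h]

lemma iverson_forall {ι : Type*} [Fintype ι] (p : ι → Prop) :
    iverson (∀ i, p i) = ∏ i, iverson (p i) := by
  by_cases h : ∀ i, p i
  · simp [iverson, h]
  · rw [iverson_of_not h]
    push Not at h
    obtain ⟨i, hi⟩ := h
    exact (Finset.prod_eq_zero (mem_univ i) (iverson_of_not hi)).symm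

lemma expect_prod_apply {β ι : Type*} [Fintype β] [Fintype ι] [DecidableEq ι] (h : β → ℝ) :
    𝔼 x : ι → β, ∏ i, h (x i) = (𝔼 b, h b) ^ Fintype.card ι := by
  have key : (∑ b, h b) ^ Fintype.card ι = ∑ x : ι → β, ∏ i, h (x i) := by
    rw [← Finset.card_univ, ← Finset.prod_const, Finset.prod_univ_sum, Fintype.piFinset_univ]
  simp only [Fintype.expect_eq_sum_div_card, div_pow, Fintype.card_fun, Nat.cast_pow, key]

/-- If every dense section contains a member of a finite family, then some member of the family is
contained in many sections. -/
lemma exists_popular {X Y L : Type*} [Fintype X] [Nonempty X] [Fintype Y] [Nonempty Y] [Fintype L]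
    (R : X → Y → Prop) (S : L → X → Prop) {δ : ℝ} (hδ : 0 < δ)
    (hS : ∀ y, δ ≤ 𝔼 x, iverson (R x y) → ∃ l, ∀ x, S l x → R x y)
    (hR : 2 * δ ≤ 𝔼 x, 𝔼 y, iverson (R x y)) :
    ∃ l, δ / Fintype.card L ≤ 𝔼 y, iverson (∀ x, S l x → R x y) := by
  have key : ∀ y, 𝔼 x, iverson (R x y) ≤ δ + ∑ l, iverson (∀ x, S l x → R x y) := by
    intro y
    have hs : 0 ≤ ∑ l, iverson (∀ x, S l x → R x y) := sum_nonneg fun _ _ ↦ iverson_nonneg _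
    rcases lt_or_ge (𝔼 x, iverson (R x y)) δ with h | h
    · linarith
    · obtain ⟨l, hl⟩ := hS y h
      have h1 : 1 ≤ ∑ l, iverson (∀ x, S l x → R x y) := by
        rw [← iverson_of hl]
        exact single_le_sum (f := fun l ↦ iverson (∀ x, S l x → R x y))
          (fun _ _ ↦ iverson_nonneg _) (mem_univ l)
      have h2 : 𝔼 x, iverson (R x y) ≤ 1 := expect_le univ_nonempty fun x _ ↦ iverson_le_one _
      linarith
  have h2 : δ ≤ ∑ l, 𝔼 y, iverson (∀ x, S l x → R x y) := by
    rw [expect_comm] at hR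
    have := hR.trans (expect_le_expect fun y _ ↦ key y)
    rw [expect_add_distrib, Fintype.expect_const, expect_sum_comm] at this
    linarith
  have hL : (univ : Finset L).Nonempty := by
    by_contra hne
    rw [not_nonempty_iff_eq_empty] at hne
    rw [hne, sum_empty] at h2
    linarith
  have hL' : (0 : ℝ) < Fintype.card L := by
    have := hL.card_pos
    rw [Finset.card_univ] at this
    exact_mod_cast this
  obtain ⟨l, -, hl⟩ := exists_le_of_sum_le (f := fun _ ↦ δ / Fintype.card L)
    (g := fun l ↦ 𝔼 y, iverson (∀ x, S l x → R x y)) hL (by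
    rw [sum_const, Finset.card_univ, nsmul_eq_mul, mul_div_cancel₀ _ hL'.ne']
    exact h2)
  exact ⟨l, hl⟩

end Expect

section Multidimensional

/-- In sufficiently large dimension, every set of words over `α` of density at least `δ` contains a
combinatorial line. -/
def DenseHasLine (α : Type) [Fintype α] (δ : ℝ) : Prop :=
  ∃ n : ℕ, ∀ (ι : Type) [Fintype ι] [DecidableEq ι], n ≤ Fintype.card ι → ∀ A : Set (ι → α),
    δ ≤ 𝔼 x, iverson (x ∈ A) → ∃ l : Line α ι, ∀ a, l a ∈ A

/-- The density Hales–Jewett property of an alphabet. -/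
def IsDHJ (α : Type) [Fintype α] : Prop := ∀ δ : ℝ, 0 < δ → DenseHasLine α δ

/-- The subspace spanned by a line and a subspace in complementary coordinates. -/
def lineProd {α ι ι₁ ι₂ : Type*} {m : ℕ} (e : ι₁ ⊕ ι₂ ≃ ι) (l : Line α ι₁)
    (V : Subspace (Fin m) α ι₂) : Subspace (Fin (m + 1)) α ι where
  idxFun i := (e.symm i).elim (fun j ↦ (l.idxFun j).elim (Sum.inr 0) Sum.inl)
    (fun j ↦ (V.idxFun j).map id Fin.succ)
  proper k := by
    refine Fin.cases ?_ (fun k ↦ ?_) k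
    · obtain ⟨j, hj⟩ := l.proper
      exact ⟨e (Sum.inl j), by simp [hj]⟩
    · obtain ⟨j, hj⟩ := V.proper k
      exact ⟨e (Sum.inr j), by simp [hj]⟩

lemma lineProd_apply {α ι ι₁ ι₂ : Type*} {m : ℕ} (e : ι₁ ⊕ ι₂ ≃ ι) (l : Line α ι₁)
    (V : Subspace (Fin m) α ι₂) (x : Fin (m + 1) → α) :
    lineProd e l V x = join e (l (x 0)) (V (x ∘ Fin.succ)) := by
  refine funext_join e (fun i ↦ ?_) (fun i ↦ ?_)
  · cases h : l.idxFun i <;> simp [lineProd, Subspace.coe_apply, h]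
  · cases h : V.idxFun i <;> simp [lineProd, Subspace.coe_apply, h]

lemma IsDHJ.exists_subspace {α : Type} [Fintype α] [Nonempty α] (h : IsDHJ α) (m : ℕ) :
    ∀ δ : ℝ, 0 < δ → ∃ n : ℕ, ∀ (ι : Type) [Fintype ι] [DecidableEq ι], n ≤ Fintype.card ι →
      ∀ A : Set (ι → α), δ ≤ 𝔼 x, iverson (x ∈ A) →
        ∃ V : Subspace (Fin m) α ι, ∀ x, V x ∈ A := by
  induction m with
  | zero =>
    intro δ hδ
    refine ⟨0, fun ι _ _ _ A hA ↦ ?_⟩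
    obtain ⟨x, -, hx⟩ := exists_le_of_le_expect univ_nonempty hA
    have hxA : x ∈ A := by
      by_contra hxA
      rw [iverson_of_not hxA] at hx
      linarith
    refine ⟨⟨Sum.inl ∘ x, fun e ↦ e.elim0⟩, fun y ↦ ?_⟩
    exact hxA
  | succ m ih =>
    intro δ hδ
    obtain ⟨n₁, hn₁⟩ := h (δ / 2) (by linarith)
    have := Fintype.ofFinite (Line α (Fin n₁))
    set θ := δ / 2 / Fintype.card (Line α (Fin n₁)) with hθ
    rcases isEmpty_or_nonempty (Line α (Fin n₁)) with hL | hL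
    · refine ⟨n₁, fun ι _ _ hι A hA ↦ ?_⟩
      obtain ⟨l, -⟩ := hn₁ (Fin n₁) (by simp) Set.univ (by
        have : δ ≤ 1 := hA.trans (expect_le univ_nonempty fun x _ ↦ iverson_le_one _)
        simp only [Set.mem_univ, iverson_of, Fintype.expect_const]
        linarith)
      exact hL.elim l
    obtain ⟨n₂, hn₂⟩ := ih θ (by positivity)
    refine ⟨n₁ + n₂, fun ι _ _ hι A hA ↦ ?_⟩
    obtain ⟨e⟩ := exists_splitting ι (n := n₁) (by omega) (Fin n₁) (by simp)
    rw [← expect_join e] at hA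
    obtain ⟨l, hl⟩ := exists_popular (fun x y ↦ join e x y ∈ A)
      (fun (l : Line α (Fin n₁)) x ↦ ∃ a, l a = x) (δ := δ / 2) (by linarith)
      (fun y hy ↦ by
        obtain ⟨l, hl⟩ := hn₁ (Fin n₁) (by simp) {x | join e x y ∈ A} hy
        exact ⟨l, by rintro _ ⟨a, rfl⟩; exact hl a⟩)
      (by linarith)
    obtain ⟨V, hV⟩ := hn₂ _ (by simp; omega) {y | ∀ x, (∃ a, l a = x) → join e x y ∈ A} hl
    refine ⟨lineProd e l V, fun x ↦ ?_⟩
    rw [lineProd_apply]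
    exact hV _ _ ⟨_, rfl⟩

end Multidimensional

section Insensitive

variable {α κ ι : Type*}

/-- Replace the extra letter `none` by `a`. -/
def fill (a : α) (x : ι → Option α) (i : ι) : Option α := some ((x i).getD a)

lemma fill_subspace_fill (a : α) (V : Subspace κ (Option α) ι) (x : κ → Option α) :
    fill a (V (fill a x)) = fill a (V x) := by
  ext i
  cases h : V.idxFun i <;> simp [fill, Subspace.coe_apply, h]

/-- A set of words is insensitive to interchanging the letters `a` and `none`. -/
def Insensitive (a : α) (D : Set (ι → Option α)) : Prop := ∀ x, fill a x ∈ D ↔ x ∈ D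

lemma Insensitive.preimage {a : α} {D : Set (ι → Option α)} (h : Insensitive a D)
    (V : Subspace κ (Option α) ι) : Insensitive a {x | V x ∈ D} := fun x ↦ by
  rw [Set.mem_ofPred_eq, Set.mem_ofPred_eq, ← h, fill_subspace_fill, h]

/-- Keep the letters `none` of the first word and take all other letters from the second. -/
def mix (z : ι → Option α) (u : ι → α) (i : ι) : Option α := (z i).map fun _ ↦ u i

lemma expect_mix [Fintype ι] [DecidableEq ι] [Fintype α] [Nonempty α]
    (F : (ι → Option α) → ℝ) :
    𝔼 z : ι → Option α, 𝔼 u : ι → α, F (mix z u) = 𝔼 x, F x := by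
  have h : 𝔼 x, F x = 𝔼 z : ι → Option α, 𝔼 _u : ι → α, F z := by simp
  rw [h, ← Finset.expect_product' (s := univ) (t := univ) (f := fun z u ↦ F (mix z u)),
    ← Finset.expect_product' (s := univ) (t := univ) (f := fun z (_ : ι → α) ↦ F z)]
  have hinv : Involutive (fun p : (ι → Option α) × (ι → α) ↦
      (mix p.1 p.2, fun i ↦ (p.1 i).getD (p.2 i))) := by
    rintro ⟨z, u⟩
    refine Prod.ext (funext fun i ↦ ?_) (funext fun i ↦ ?_) <;>
      cases h : z i <;> simp [mix, h]
  exact Fintype.expect_bijective _ hinv.bijective _ _ fun _ ↦ rfl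

/-- A subspace over the smaller alphabet in the coordinates where `z` is not `none`, regarded as a
subspace over the larger alphabet. -/
def extend {m : ℕ} (z : ι → Option α) (V : Subspace (Fin m) α {i // z i ≠ none}) :
    Subspace (Fin m) (Option α) ι where
  idxFun i := open Classical in if h : z i ≠ none then (V.idxFun ⟨i, h⟩).map some id
    else Sum.inl none
  proper e := by
    obtain ⟨⟨i, hi⟩, h⟩ := V.proper e
    exact ⟨i, by simp [hi, h]⟩

lemma extend_apply_some {m : ℕ} (z : ι → Option α) (V : Subspace (Fin m) α {i // z i ≠ none})
    (x : Fin m → α) (u : ι → α) (hu : ∀ i : {i // z i ≠ none}, u i = V x i) :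
    extend z V (some ∘ x) = mix z u := by
  ext1 i
  by_cases hi : z i = none
  · simp [extend, mix, Subspace.coe_apply, hi]
  · have := hu ⟨i, hi⟩
    obtain ⟨a, ha⟩ := Option.ne_none_iff_exists'.1 hi
    cases h : V.idxFun ⟨i, hi⟩ <;> simp_all [extend, mix, Subspace.coe_apply]

/-- Words with few letters other than `none` have small density. -/
lemma expect_few_le [Fintype ι] [DecidableEq ι] [Fintype α] (n : ℕ) :
    𝔼 z : ι → Option α, iverson (Nat.card {i // z i ≠ none} < n) ≤
      2 ^ n * (1 - Fintype.card α / (2 * (Fintype.card α + 1)) : ℝ) ^ Fintype.card ι := by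
  classical
  let h : Option α → ℝ := fun b ↦ b.elim 1 fun _ ↦ 1 / 2
  have hh : 𝔼 b, h b = 1 - Fintype.card α / (2 * (Fintype.card α + 1)) := by
    rw [Fintype.expect_eq_sum_div_card, Fintype.sum_option]
    simp [h]
    field_simp
    ring
  rw [← hh, ← expect_prod_apply, mul_expect]
  refine expect_le_expect fun z _ ↦ ?_
  have hz : ∏ i, h (z i) = (1 / 2) ^ Nat.card {i // z i ≠ none} := by
    rw [Nat.card_eq_fintype_card, Fintype.card_subtype, ← prod_const, prod_filter]
    refine prod_congr rfl fun i _ ↦ ?_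
    cases hi : z i <;> simp [h]
  rw [hz]
  by_cases hlt : Nat.card {i // z i ≠ none} < n
  · rw [iverson_of hlt, one_div, inv_pow, ← div_eq_mul_inv, one_le_div (by positivity)]
    exact pow_le_pow_right₀ (by norm_num) hlt.le
  · rw [iverson_of_not hlt]
    positivity

end Insensitive

lemma IsDHJ.exists_subspace_insensitive {α : Type} [Fintype α] [Nonempty α] (hα : IsDHJ α)
    (m : ℕ) {η : ℝ} (hη : 0 < η) :
    ∃ n : ℕ, ∀ (ι : Type) [Fintype ι] [DecidableEq ι], n ≤ Fintype.card ι →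
      ∀ (a : α) (D : Set (ι → Option α)), Insensitive a D → η ≤ 𝔼 x, iverson (x ∈ D) →
        ∃ V : Subspace (Fin m) (Option α) ι, ∀ x, V x ∈ D := by
  classical
  obtain ⟨n₀, hn₀⟩ := hα.exists_subspace m (η / 2) (by linarith)
  set q : ℝ := 1 - Fintype.card α / (2 * (Fintype.card α + 1)) with hq
  have hcard : (0 : ℝ) < Fintype.card α := by exact_mod_cast Fintype.card_pos
  have hq0 : 0 ≤ q := by
    rw [hq, sub_nonneg, div_le_one (by positivity)]
    linarith
  have hq1 : q < 1 := by
    have : 0 < (Fintype.card α / (2 * (Fintype.card α + 1)) : ℝ) := by positivity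
    linarith
  obtain ⟨n, hn⟩ := exists_pow_lt_of_lt_one (show 0 < η / 2 / 2 ^ n₀ by positivity) hq1
  refine ⟨n, fun ι _ _ hι a D hD hdens ↦ ?_⟩
  have hfew : 𝔼 z : ι → Option α, iverson (Nat.card {i // z i ≠ none} < n₀) < η / 2 := by
    refine (expect_few_le n₀).trans_lt ?_
    have : q ^ Fintype.card ι < η / 2 / 2 ^ n₀ :=
      (pow_le_pow_of_le_one hq0 hq1.le hι).trans_lt hn
    rwa [lt_div_iff₀ (by positivity), mul_comm] at this
  obtain ⟨z, hz, hzD⟩ : ∃ z : ι → Option α, n₀ ≤ Nat.card {i // z i ≠ none} ∧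
      η / 2 ≤ 𝔼 u, iverson (mix z u ∈ D) := by
    by_contra! hcon
    rw [← expect_mix (fun x ↦ iverson (x ∈ D))] at hdens
    have : 𝔼 z : ι → Option α, 𝔼 u : ι → α, iverson (mix z u ∈ D) ≤
        𝔼 z : ι → Option α, (iverson (Nat.card {i // z i ≠ none} < n₀) + η / 2) := by
      refine expect_le_expect fun z _ ↦ ?_
      by_cases h : Nat.card {i // z i ≠ none} < n₀
      · rw [iverson_of h]
        have : 𝔼 u : ι → α, iverson (mix z u ∈ D) ≤ 1 :=
          expect_le univ_nonempty fun x _ ↦ iverson_le_one _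
        linarith
      · rw [iverson_of_not h, zero_add]
        exact (hcon z (not_lt.1 h)).le
    rw [expect_add_distrib, Fintype.expect_const] at this
    linarith
  let e := Equiv.sumCompl fun i ↦ z i ≠ none
  rw [← expect_join e, expect_comm] at hzD
  obtain ⟨w, -, hw⟩ := exists_le_of_le_expect univ_nonempty hzD
  obtain ⟨V, hV⟩ := hn₀ {i // z i ≠ none} (by rwa [← Nat.card_eq_fintype_card])
    {v | mix z (join e v w) ∈ D} hw
  refine ⟨extend z V, fun x ↦ ?_⟩
  let x' : Fin m → α := fun i ↦ (x i).getD a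
  have hx : extend z V (fill a x) = mix z (join e (V x') w) :=
    extend_apply_some z V x' _ fun i ↦ join_inl e (V x') w i
  rw [← hD, ← fill_subspace_fill, hD, hx]
  exact hV x'

section Increment

variable {α : Type} [Fintype α]

lemma expect_mul_range {β κ ι : Type*} [Fintype β] [Nonempty β] [Fintype κ] [DecidableEq κ]
    [Fintype ι] [DecidableEq ι] (U : Subspace κ β ι) (g : (ι → β) → ℝ) :
    𝔼 x, g x * iverson (∃ z, U z = x) =
      Fintype.card (κ → β) / Fintype.card (ι → β) * 𝔼 z, g (U z) := by
  classical
  have h : ∑ x, g x * iverson (∃ z, U z = x) = ∑ z, g (U z) := by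
    rw [← sum_image (s := univ) (f := g) (g := fun z ↦ U z) (fun _ _ _ _ h ↦ U.injective h)]
    simp only [iverson, mul_ite, mul_one, mul_zero]
    rw [← sum_filter]
    congr 1
    ext x
    simp
  have h1 : (0 : ℝ) < Fintype.card (κ → β) := by exact_mod_cast Fintype.card_pos
  have h2 : (0 : ℝ) < Fintype.card (ι → β) := by exact_mod_cast Fintype.card_pos
  rw [Fintype.expect_eq_sum_div_card, Fintype.expect_eq_sum_div_card, h]
  field_simp

/-- The quantitative form of `IsDHJ.expect_mul_insensitive_le`, after splitting off `s` times a
subspace contained in many sections. -/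
lemma expect_mul_insensitive_le_of_pow {m n : ℕ} {ε η : ℝ} (hε : 0 ≤ ε) (hη : 0 < η) (a : α)
    [Fintype (Subspace (Fin m) (Option α) (Fin n))]
    (hn : ∀ D : Set (Fin n → Option α), Insensitive a D → η / 2 ≤ 𝔼 x, iverson (x ∈ D) →
      ∃ V : Subspace (Fin m) (Option α) (Fin n), ∀ x, V x ∈ D) {r : ℝ} (hr0 : 0 ≤ r) (hr : r ≤ 1)
    (hr' : r ≤ Fintype.card (Fin m → Option α) / Fintype.card (Fin n → Option α) *
      (η / 2 / Fintype.card (Subspace (Fin m) (Option α) (Fin n)))) (s : ℕ) :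
    ∀ (ι : Type) [Fintype ι] [DecidableEq ι], s * n ≤ Fintype.card ι →
      ∀ D : Set (ι → Option α), Insensitive a D → ∀ f : (ι → Option α) → ℝ, (∀ x, f x ≤ 1) →
        (∀ V : Subspace (Fin m) (Option α) ι, 𝔼 x, f (V x) ≤ ε) →
          𝔼 x, f x * iverson (x ∈ D) ≤ (ε + (1 - r) ^ s) * (𝔼 x, iverson (x ∈ D)) + η := by
  induction s with
  | zero =>
    intro ι _ _ _ D _ f hf _
    have h1 : 𝔼 x, f x * iverson (x ∈ D) ≤ 𝔼 x, iverson (x ∈ D) :=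
      expect_le_expect fun x _ ↦ mul_le_of_le_one_left (iverson_nonneg _) (hf x)
    have h2 : 0 ≤ 𝔼 x, iverson (x ∈ D) := expect_nonneg fun _ _ ↦ iverson_nonneg _
    have := mul_nonneg hε h2
    rw [pow_zero]
    linarith
  | succ s ih =>
    intro ι _ _ hι D hD f hf hV
    have hd0 : 0 ≤ 𝔼 x, iverson (x ∈ D) := expect_nonneg fun _ _ ↦ iverson_nonneg _
    have hd1 : 𝔼 x, iverson (x ∈ D) ≤ 1 := expect_le univ_nonempty fun x _ ↦ iverson_le_one _
    have hp : 0 ≤ (1 - r) ^ s := pow_nonneg (by linarith) s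
    rcases lt_or_ge (𝔼 x, iverson (x ∈ D)) η with hlt | hge
    · have h1 : 𝔼 x, f x * iverson (x ∈ D) ≤ 𝔼 x, iverson (x ∈ D) :=
        expect_le_expect fun x _ ↦ mul_le_of_le_one_left (iverson_nonneg _) (hf x)
      have : 0 ≤ (ε + (1 - r) ^ (s + 1)) * (𝔼 x, iverson (x ∈ D)) :=
        mul_nonneg (add_nonneg hε (pow_nonneg (by linarith) _)) hd0
      linarith
    have hcard : n + s * n ≤ Fintype.card ι := by linarith
    obtain ⟨e⟩ := exists_splitting ι (n := n) (by omega) (Fin n) (by simp)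
    set ι₂ := Fin (Fintype.card ι - n)
    rw [← expect_join e] at hge
    obtain ⟨U, hU⟩ := exists_popular (fun x y ↦ join e x y ∈ D)
      (fun (U : Subspace (Fin m) (Option α) (Fin n)) x ↦ ∃ z, U z = x) (δ := η / 2) (by linarith)
      (fun y hy ↦ by
        have hins := hD.preimage (fixRight e y)
        simp only [fixRight_apply] at hins
        obtain ⟨V, hV⟩ := hn {x | join e x y ∈ D} hins hy
        exact ⟨V, by rintro _ ⟨z, rfl⟩; exact hV z⟩)
      (by linarith)
    set T : Set (ι₂ → Option α) := {y | ∀ x, (∃ z, U z = x) → join e x y ∈ D} with hT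
    change _ ≤ 𝔼 y, iverson (y ∈ T) at hU
    let R : (Fin n → Option α) → Set (ι₂ → Option α) :=
      fun x ↦ {y | join e x y ∈ D ∧ ¬((∃ z, U z = x) ∧ y ∈ T)}
    have hDx : ∀ x y, join e x (fill a y) ∈ D ↔ join e x y ∈ D := by
      intro x
      have hins := hD.preimage (fixLeft e x)
      simp only [fixLeft_apply] at hins
      exact hins
    have hTins : Insensitive a T := fun y ↦ by
      simp only [hT, Set.mem_ofPred_eq, hDx]
    have hRins : ∀ x, Insensitive a (R x) := fun x y ↦ by
      simp only [R, Set.mem_ofPred_eq, hDx, hTins y]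
    have hdecomp : ∀ x y, iverson (join e x y ∈ D) =
        iverson (∃ z, U z = x) * iverson (y ∈ T) + iverson (y ∈ R x) := by
      intro x y
      rw [← iverson_and]
      by_cases h : (∃ z, U z = x) ∧ y ∈ T
      · have h1 : join e x y ∈ D := h.2 x h.1
        have h2 : y ∉ R x := fun hy ↦ hy.2 h
        rw [iverson_of h, iverson_of h1, iverson_of_not h2, add_zero]
      · rw [iverson_of_not h, zero_add]
        congr 1
        exact propext ⟨fun h1 ↦ ⟨h1, h⟩, fun h1 ↦ h1.1⟩
    set c : ℝ := Fintype.card (Fin m → Option α) / Fintype.card (Fin n → Option α) with hc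
    have hc0 : 0 ≤ c := by positivity
    set τ := 𝔼 y, iverson (y ∈ T) with hτ
    set ρ := 𝔼 x, 𝔼 y, iverson (y ∈ R x) with hρ
    have hdens : 𝔼 x, iverson (x ∈ D) = c * τ + ρ := by
      rw [← expect_join e]
      simp only [hdecomp, expect_add_distrib, ← mul_expect]
      rw [← hρ, ← hτ, ← expect_mul]
      congr 2
      have := expect_mul_range U fun _ ↦ 1
      simpa only [one_mul, mul_one, Fintype.expect_const] using this
    have hmain : 𝔼 x, f x * iverson (x ∈ D) =
        (𝔼 y, iverson (y ∈ T) * (c * 𝔼 z, f (join e (U z) y))) +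
          𝔼 x, 𝔼 y, f (join e x y) * iverson (y ∈ R x) := by
      rw [← expect_join e]
      simp only [hdecomp, mul_add, expect_add_distrib]
      congr 1
      rw [expect_comm]
      refine expect_congr rfl fun y _ ↦ ?_
      rw [← expect_mul_range U fun x ↦ f (join e x y), mul_expect]
      exact expect_congr rfl fun x _ ↦ by ring
    have h1 : 𝔼 y, iverson (y ∈ T) * (c * 𝔼 z, f (join e (U z) y)) ≤ τ * (c * ε) := by
      rw [hτ, expect_mul]
      refine expect_le_expect fun y _ ↦ ?_
      have := hV ((fixRight e y).comp U)
      simp only [Subspace.comp_apply, fixRight_apply] at this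
      have := iverson_nonneg (y ∈ T)
      gcongr
    have h2 : 𝔼 x, 𝔼 y, f (join e x y) * iverson (y ∈ R x) ≤ (ε + (1 - r) ^ s) * ρ + η := by
      have : 𝔼 x, 𝔼 y, f (join e x y) * iverson (y ∈ R x) ≤
          𝔼 x, ((ε + (1 - r) ^ s) * (𝔼 y, iverson (y ∈ R x)) + η) := by
        refine expect_le_expect fun x _ ↦ ih ι₂ (by simp [ι₂]; omega) (R x) (hRins x)
          (fun y ↦ f (join e x y)) (fun _ ↦ hf _) fun V ↦ ?_
        have := hV ((fixLeft e x).comp V)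
        simpa only [Subspace.comp_apply, fixLeft_apply] using this
      rwa [expect_add_distrib, Fintype.expect_const, ← mul_expect] at this
    have hcτ : r ≤ c * τ := hr'.trans (mul_le_mul_of_nonneg_left hU hc0)
    rw [hmain, hdens]
    rw [hdens] at hd0 hd1
    have hρd : ρ ≤ (1 - r) * (c * τ + ρ) := by nlinarith
    rw [pow_succ]
    nlinarith [mul_le_mul_of_nonneg_left hρd hp]

/-- A function with small averages on large subspaces has small average on insensitive sets. -/
lemma IsDHJ.expect_mul_insensitive_le [Nonempty α] (hα : IsDHJ α) (m : ℕ) {ε : ℝ} (hε : 0 < ε) :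
    ∃ n : ℕ, ∀ (ι : Type) [Fintype ι] [DecidableEq ι], n ≤ Fintype.card ι →
      ∀ (a : α) (D : Set (ι → Option α)), Insensitive a D → ∀ f : (ι → Option α) → ℝ,
        (∀ x, f x ≤ 1) → (∀ d, m ≤ d → ∀ V : Subspace (Fin d) (Option α) ι, 𝔼 x, f (V x) ≤ ε) →
          𝔼 x, f x * iverson (x ∈ D) ≤ 2 * ε := by
  rcases lt_or_ge 1 ε with h1 | h1
  · refine ⟨0, fun ι _ _ _ a D _ f hf _ ↦ ?_⟩
    have : 𝔼 x, f x * iverson (x ∈ D) ≤ 1 := expect_le univ_nonempty fun x _ ↦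
      (mul_le_of_le_one_left (iverson_nonneg _) (hf x)).trans (iverson_le_one _)
    linarith
  obtain ⟨n, hn⟩ := hα.exists_subspace_insensitive m (η := ε / 2 / 2) (by linarith)
  have := Fintype.ofFinite (Subspace (Fin m) (Option α) (Fin n))
  have hne : Nonempty (Subspace (Fin m) (Option α) (Fin n)) := by
    obtain ⟨V, -⟩ := hn (Fin n) (by simp) (Classical.arbitrary α) Set.univ (fun _ ↦ by simp) (by
      simp only [Set.mem_univ, iverson_of, Fintype.expect_const]
      linarith)
    exact ⟨V⟩
  obtain ⟨r, hr0, hr⟩ : ∃ r : ℝ, 0 < r ∧ r ≤ min 1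
      (Fintype.card (Fin m → Option α) / Fintype.card (Fin n → Option α) *
      (ε / 2 / 2 / Fintype.card (Subspace (Fin m) (Option α) (Fin n)))) :=
    ⟨_, by positivity, le_rfl⟩
  have hr1 : r ≤ 1 := hr.trans (min_le_left _ _)
  obtain ⟨s, hs⟩ := exists_pow_lt_of_lt_one (show 0 < ε / 2 by linarith)
    (show 1 - r < 1 by linarith)
  refine ⟨s * n, fun ι _ _ hι a D hD f hf hV ↦ ?_⟩
  have := expect_mul_insensitive_le_of_pow hε.le (η := ε / 2) (by linarith) a
    (hn (Fin n) (by simp) a) hr0.le hr1 (hr.trans (min_le_right _ _)) s ι hι D hD f hf (hV m le_rfl)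
  have hd0 : 0 ≤ 𝔼 x, iverson (x ∈ D) := expect_nonneg fun _ _ ↦ iverson_nonneg _
  have hd1 : 𝔼 x, iverson (x ∈ D) ≤ 1 := expect_le univ_nonempty fun x _ ↦ iverson_le_one _
  have hp : 0 ≤ (1 - r) ^ s := pow_nonneg (by linarith) s
  nlinarith

/-- A function with small averages on large subspaces has small average on the complement of an
intersection of insensitive sets. -/
lemma IsDHJ.expect_mul_compl_le [Nonempty α] [DecidableEq α] (hα : IsDHJ α) (m : ℕ) {ε : ℝ}
    (hε : 0 < ε) (S : Finset α) :
    ∃ n : ℕ, ∀ (ι : Type) [Fintype ι] [DecidableEq ι], n ≤ Fintype.card ι →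
      ∀ D : α → Set (ι → Option α), (∀ a, Insensitive a (D a)) → ∀ f : (ι → Option α) → ℝ,
        (∀ x, f x ≤ 1) → (∀ d, m ≤ d → ∀ V : Subspace (Fin d) (Option α) ι, 𝔼 x, f (V x) ≤ ε) →
          𝔼 x, f x * iverson (¬∀ a ∈ S, x ∈ D a) ≤ 4 ^ #S * ε := by
  induction S using Finset.induction_on with
  | empty =>
    refine ⟨0, fun ι _ _ _ D _ f _ _ ↦ ?_⟩
    simp only [iverson, notMem_empty, false_imp_iff, implies_true, not_true_eq_false, if_false,
      mul_zero, expect_const_zero]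
    positivity
  | insert b S hb ih =>
    obtain ⟨n₁, hn₁⟩ := ih
    obtain ⟨n₂, hn₂⟩ := hα.expect_mul_insensitive_le m hε
    obtain ⟨n₃, hn₃⟩ := hα.expect_mul_insensitive_le (max m n₁) (ε := 4 ^ #S * ε) (by positivity)
    refine ⟨max n₂ n₃, fun ι _ _ hι D hD f hf hV ↦ ?_⟩
    have h₂ := hn₂ ι (by omega) b (D b)ᶜ (fun x ↦ not_congr (hD b x)) f hf hV
    have h₃ := hn₃ ι (by omega) b (D b) (hD b) (fun x ↦ f x * iverson (¬∀ a ∈ S, x ∈ D a))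
      (fun x ↦ (mul_le_of_le_one_left (iverson_nonneg _) (hf x)).trans (iverson_le_one _))
      (fun d hd V ↦ hn₁ (Fin d) (by simp; omega) (fun a ↦ {x | V x ∈ D a})
        (fun a ↦ (hD a).preimage V) (fun x ↦ f (V x)) (fun _ ↦ hf _) fun d' hd' W ↦ by
          simpa only [Subspace.comp_apply] using hV d' hd' (V.comp W))
    have hsplit : ∀ x, f x * iverson (¬∀ a ∈ insert b S, x ∈ D a) =
        f x * iverson (x ∈ (D b)ᶜ) + f x * iverson (¬∀ a ∈ S, x ∈ D a) * iverson (x ∈ D b) := by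
      intro x
      rw [Finset.forall_mem_insert, iverson_not, iverson_and, iverson_not,
        show iverson (x ∈ (D b)ᶜ) = 1 - iverson (x ∈ D b) from iverson_not _]
      ring
    simp only [hsplit, expect_add_distrib]
    rw [card_insert_of_notMem hb, pow_succ]
    have : ε ≤ 4 ^ #S * ε := le_mul_of_one_le_left hε.le (one_le_pow₀ (by norm_num))
    linarith

end Increment

section Induction

lemma expect_lt_of_lineFree {β ι : Type} [Fintype β] {A : Set (ι → β)}
    (hA : ∀ l : Line β ι, ∃ b, l b ∉ A) {δ : ℝ} {n : ℕ}
    (hn : ∀ (κ : Type) [Fintype κ] [DecidableEq κ], n ≤ Fintype.card κ → ∀ A : Set (κ → β),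
      δ ≤ 𝔼 x, iverson (x ∈ A) → ∃ l : Line β κ, ∀ b, l b ∈ A)
    {κ : Type} [Fintype κ] [DecidableEq κ] (hκ : n ≤ Fintype.card κ) (V : Subspace κ β ι) :
    𝔼 x, iverson (V x ∈ A) < δ := by
  by_contra! h
  obtain ⟨l, hl⟩ := hn κ hκ {x | V x ∈ A} h
  obtain ⟨b, hb⟩ := hA (V.compLine l)
  rw [Subspace.compLine_apply] at hb
  exact hb (hl b)

/-- If no value exceeds the mean much, then no value is much smaller than the mean. -/
lemma sub_le_of_forall_le_of_le_expect {X : Type*} [Fintype X] [Nonempty X] {g : X → ℝ}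
    {c ε : ℝ} (hε : 0 ≤ ε) (hg : ∀ x, g x ≤ c + ε / (2 * Fintype.card X))
    (hmean : c - ε / (2 * Fintype.card X) ≤ 𝔼 x, g x) (x : X) : c - ε ≤ g x := by
  classical
  have hX : (0 : ℝ) < Fintype.card X := by exact_mod_cast Fintype.card_pos
  set t := ε / (2 * Fintype.card X) with ht
  have hsum : (c + t) - g x ≤ ∑ x, ((c + t) - g x) :=
    single_le_sum (f := fun x ↦ (c + t) - g x) (fun x _ ↦ sub_nonneg.2 (hg x)) (mem_univ x)
  rw [← Fintype.card_mul_expect, expect_sub_distrib, Fintype.expect_const] at hsum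
  have h1 : (Fintype.card X : ℝ) * (c + t - 𝔼 x, g x) ≤ Fintype.card X * (2 * t) :=
    mul_le_mul_of_nonneg_left (by linarith) hX.le
  have h2 : (Fintype.card X : ℝ) * (2 * t) = ε := by
    rw [ht]
    field_simp
  have h3 : 0 ≤ t := by positivity
  linarith

/-- A line in the extended alphabet all of whose points agree outside of the coordinates where `v`
takes the value `none`. -/
def fillLine {α ι ι₁ ι₂ : Type*} (e : ι₁ ⊕ ι₂ ≃ ι) (v : ι₁ → Option α) (y : ι₂ → Option α)
    (hv : ∃ i, v i = none) : Line (Option α) ι where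
  idxFun i := (e.symm i).elim (fun j ↦ (v j).map some) (some ∘ y)
  proper := by
    obtain ⟨i, hi⟩ := hv
    exact ⟨e (Sum.inl i), by simp [hi]⟩

lemma fillLine_none {α ι ι₁ ι₂ : Type*} (e : ι₁ ⊕ ι₂ ≃ ι) (v : ι₁ → Option α)
    (y : ι₂ → Option α) (hv : ∃ i, v i = none) : fillLine e v y hv none = join e v y := by
  refine funext_join e (fun i ↦ ?_) (fun i ↦ ?_)
  · cases h : v i <;> simp [fillLine, h]
  · simp [fillLine]

lemma fillLine_some {α ι ι₁ ι₂ : Type*} (e : ι₁ ⊕ ι₂ ≃ ι) (v : ι₁ → Option α)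
    (y : ι₂ → Option α) (hv : ∃ i, v i = none) (a : α) :
    fillLine e v y hv (some a) = join e (fill a v) y := by
  refine funext_join e (fun i ↦ ?_) (fun i ↦ ?_)
  · cases h : v i <;> simp [fillLine, fill, h]
  · simp [fillLine]

lemma expect_forall_ne_none {α ι : Type*} [Fintype α] [Fintype ι] [DecidableEq ι] :
    𝔼 r : ι → Option α, iverson (∀ t, r t ≠ none) =
      (Fintype.card α / (Fintype.card α + 1) : ℝ) ^ Fintype.card ι := by
  have h : 𝔼 b : Option α, iverson (b ≠ none) = Fintype.card α / (Fintype.card α + 1) := by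
    rw [Fintype.expect_eq_sum_div_card, Fintype.sum_option]
    simp [iverson]
  simp only [iverson_forall]
  rw [expect_prod_apply (fun b : Option α ↦ iverson (b ≠ none)), h]

/-- If every fibre `A x` is dense, then there is a subspace such that, with positive probability,
all the fibres over the words obtained by filling a word of this subspace have a common point. -/
lemma exists_subspace_fill {α : Type} [Fintype α] [Nonempty α] {M d : ℕ} {δ : ℝ}
    (hδ : 0 < δ) [Fintype (Line α (Fin M))]
    (hM : ∀ A : Set (Fin M → α), δ ≤ 𝔼 x, iverson (x ∈ A) → ∃ l : Line α (Fin M), ∀ a, l a ∈ A)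
    {Y : Type} [Fintype Y] [Nonempty Y] (A : (Fin M × Fin d → Option α) → Y → Prop)
    (hA : ∀ x, 2 * δ ≤ 𝔼 y, iverson (A x y)) :
    ∃ V : Subspace (Fin d) (Option α) (Fin M × Fin d),
      δ / Fintype.card (Line α (Fin M)) ≤ 𝔼 r, 𝔼 y, iverson (∀ a, A (fill a (V r)) y) := by
  classical
  let w : (Fin M × Fin d → Option α) → (Fin M → α) → (Fin M × Fin d → Option α) :=
    fun z u i ↦ some ((z i).getD (u i.1))
  obtain ⟨l, hl⟩ := exists_popular (fun u (p : (Fin M × Fin d → Option α) × Y) ↦ A (w p.1 u) p.2)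
    (fun (l : Line α (Fin M)) u ↦ ∃ a, l a = u) hδ
    (fun p hp ↦ by
      obtain ⟨l, hl⟩ := hM {u | A (w p.1 u) p.2} hp
      exact ⟨l, by rintro _ ⟨a, rfl⟩; exact hl a⟩)
    (le_expect univ_nonempty fun u _ ↦ by
      rw [← univ_product_univ, expect_product]
      exact le_expect univ_nonempty fun z _ ↦ hA (w z u))
  obtain ⟨j, hj⟩ := l.proper
  let e₁ : Fin d ≃ {p : Fin M × Fin d // p.1 = j} :=
    { toFun := fun t ↦ ⟨(j, t), rfl⟩
      invFun := fun p ↦ p.1.2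
      left_inv := fun _ ↦ rfl
      right_inv := by rintro ⟨⟨_, t⟩, rfl⟩; rfl }
  let e : Fin d ⊕ {p : Fin M × Fin d // ¬p.1 = j} ≃ Fin M × Fin d :=
    (Equiv.sumCongr e₁ (Equiv.refl _)).trans (Equiv.sumCompl fun p : Fin M × Fin d ↦ p.1 = j)
  have heinl : ∀ t, e (Sum.inl t) = (j, t) := fun _ ↦ rfl
  have heinr : ∀ p, e (Sum.inr p) = p := fun _ ↦ rfl
  rw [← univ_product_univ, expect_product, ← expect_join e, expect_comm] at hl
  obtain ⟨s, -, hs⟩ := exists_le_of_le_expect univ_nonempty hl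
  refine ⟨fixRight e fun p ↦ (s p).elim (l.idxFun p.1.1) some, hs.trans_eq ?_⟩
  refine expect_congr rfl fun r _ ↦ expect_congr rfl fun y _ ↦ ?_
  have hw : ∀ a, w (join e r s) (l a) =
      fill a (fixRight e (fun p ↦ (s p).elim (l.idxFun p.1.1) some) r) := by
    intro a
    rw [fixRight_apply]
    refine funext_join e (fun i ↦ ?_) (fun i ↦ ?_)
    · simp only [w, fill, join_inl]
      simp [heinl, hj]
    · simp only [w, fill, join_inr]
      cases h : s i <;> simp [heinr]
  congr 1
  refine propext ⟨fun h a ↦ hw a ▸ h (l a) ⟨a, rfl⟩, ?_⟩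
  rintro h _ ⟨a, rfl⟩
  exact (hw a).symm ▸ h a

/-- The density Hales–Jewett property passes to the alphabet with one more letter. -/
theorem IsDHJ.option {α : Type} [Fintype α] [DecidableEq α] [Nonempty α] (hα : IsDHJ α) :
    IsDHJ (Option α) := by
  by_contra hcon
  obtain ⟨c, hc0, hgt, hlt⟩ : ∃ c : ℝ, 0 < c ∧ (∀ δ, c < δ → DenseHasLine (Option α) δ) ∧
      ∀ δ, δ < c → ¬DenseHasLine (Option α) δ := by
    simp only [IsDHJ, not_forall] at hcon
    obtain ⟨δ₀, hδ₀, hδ₀'⟩ := hcon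
    have hmono : ∀ δ δ', δ ≤ δ' → DenseHasLine (Option α) δ → DenseHasLine (Option α) δ' := by
      rintro δ δ' h ⟨n, hn⟩
      exact ⟨n, fun ι _ _ hι A hA ↦ hn ι hι A (h.trans hA)⟩
    have hne : {δ | DenseHasLine (Option α) δ}.Nonempty := by
      refine ⟨2, 0, fun ι _ _ _ A hA ↦ ?_⟩
      have : 𝔼 x, iverson (x ∈ A) ≤ 1 := expect_le univ_nonempty fun x _ ↦ iverson_le_one _
      linarith
    have hlow : ∀ δ ∈ {δ | DenseHasLine (Option α) δ}, δ₀ ≤ δ := by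
      intro δ hδ
      by_contra! h
      exact hδ₀' (hmono δ δ₀ h.le hδ)
    refine ⟨sInf {δ | DenseHasLine (Option α) δ}, hδ₀.trans_le (le_csInf hne hlow), ?_, ?_⟩
    · intro δ hδ
      obtain ⟨δ', hδ', h⟩ := exists_lt_of_csInf_lt hne hδ
      exact hmono δ' δ h.le hδ'
    · intro δ hδ h
      exact (csInf_le ⟨δ₀, hlow⟩ h).not_gt hδ
  obtain ⟨M, hM⟩ := hα (c / 4) (by linarith)
  have := Fintype.ofFinite (Line α (Fin M))
  set θ := c / 4 / Fintype.card (Line α (Fin M)) with hθ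
  have hθ0 : 0 < θ := by
    obtain ⟨l, -⟩ := hM (Fin M) (by simp) Set.univ (by
      by_contra! h
      refine hlt (c / 2) (by linarith) ⟨0, fun ι _ _ _ A hA ↦ ?_⟩
      have h1 : 𝔼 x, iverson (x ∈ A) ≤ 1 := expect_le univ_nonempty fun x _ ↦ iverson_le_one _
      simp only [Set.mem_univ, iverson_of, Fintype.expect_const] at h
      linarith)
    have : Nonempty (Line α (Fin M)) := ⟨l⟩
    positivity
  set C : ℝ := 4 ^ #(univ : Finset α) with hC
  have hC0 : 0 < C := by positivity
  obtain ⟨ε, hε0, hε⟩ : ∃ ε : ℝ, 0 < ε ∧ ε ≤ min (c / 2) (c * θ / (4 * (C + 2))) :=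
    ⟨_, by positivity, le_rfl⟩
  have hε1 : ε ≤ c / 2 := hε.trans (min_le_left _ _)
  have hε2 : (C + 2) * ε ≤ c * θ / 4 := by
    have := hε.trans (min_le_right _ _)
    rw [le_div_iff₀ (by positivity)] at this
    linarith
  obtain ⟨m, hm⟩ := hgt (c + ε) (by linarith)
  obtain ⟨d₀, hd₀⟩ := hα.expect_mul_compl_le m hε0 univ
  have hq0 : 0 ≤ (Fintype.card α / (Fintype.card α + 1) : ℝ) := by positivity
  have hq1 : (Fintype.card α / (Fintype.card α + 1) : ℝ) < 1 := by
    rw [div_lt_one (by positivity)]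
    linarith
  obtain ⟨d₁, hd₁⟩ := exists_pow_lt_of_lt_one (show 0 < c * θ / 4 by positivity) hq1
  set d := max d₀ d₁ with hd
  set K : ℝ := (Fintype.card (Fin M × Fin d → Option α) : ℝ) with hK
  have hK0 : 0 < K := by
    rw [hK]
    exact_mod_cast Fintype.card_pos
  have hε' : 0 < ε / (2 * K) := by positivity
  obtain ⟨n, hn⟩ := hgt (c + ε / (2 * K)) (by linarith)
  have hno := hlt (c - ε / (2 * K)) (by linarith)
  simp only [DenseHasLine, not_exists, not_forall] at hno
  obtain ⟨ι, hι₁, hι₂, hι, A, hA, hfree⟩ := hno (M * d + n)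
  obtain ⟨e⟩ := exists_splitting ι (n := M * d) (by omega) (Fin M × Fin d) (by simp)
  set ι₂ := Fin (Fintype.card ι - M * d)
  rw [← expect_join e] at hA
  have hsec : ∀ x, c - ε ≤ 𝔼 y : ι₂ → Option α, iverson (join e x y ∈ A) :=
    sub_le_of_forall_le_of_le_expect hε0.le (fun x ↦ by
      have := expect_lt_of_lineFree hfree hn (by simp [ι₂]; omega) (fixLeft e x)
      simp only [fixLeft_apply] at this
      exact this.le) hA
  obtain ⟨V, hV⟩ := exists_subspace_fill (d := d) (δ := c / 4) (by linarith) (hM (Fin M) (by simp))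
    (fun x (y : ι₂ → Option α) ↦ join e x y ∈ A) (fun x ↦ by linarith [hsec x])
  have hpoint : ∀ r (y : ι₂ → Option α), iverson (join e (V r) y ∈ A) - (c + ε) ≤
      (iverson (join e (V r) y ∈ A) - (c + ε)) *
        iverson (¬∀ a ∈ univ, join e (fill a (V r)) y ∈ A) + iverson (∀ t, r t ≠ none) -
          (c + ε) * iverson (∀ a, join e (fill a (V r)) y ∈ A) := by
    intro r y
    by_cases hD : ∀ a, join e (fill a (V r)) y ∈ A
    · rw [iverson_of hD, iverson_of_not (p := ¬_) (by simpa using hD)]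
      have : iverson (join e (V r) y ∈ A) ≤ iverson (∀ t, r t ≠ none) := by
        by_cases hr : ∀ t, r t ≠ none
        · rw [iverson_of hr]
          exact iverson_le_one _
        · rw [iverson_of_not hr, iverson_of_not]
          intro hrA
          push Not at hr
          obtain ⟨t, ht⟩ := hr
          obtain ⟨i, hi⟩ := V.proper t
          obtain ⟨b, hb⟩ := hfree (fillLine e (V r) y ⟨i, by rw [Subspace.apply_inr hi, ht]⟩)
          cases b with
          | none => exact hb (by rwa [fillLine_none])
          | some a => exact hb (by rw [fillLine_some]; exact hD a)
      linarith
    · rw [iverson_of_not hD, iverson_of (p := ¬_) (by simpa using hD)]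
      linarith [iverson_nonneg (∀ t, r t ≠ none)]
  have hcompl : ∀ y : ι₂ → Option α, 𝔼 r, (iverson (join e (V r) y ∈ A) - (c + ε)) *
      iverson (¬∀ a ∈ univ, join e (fill a (V r)) y ∈ A) ≤ C * ε := by
    intro y
    refine hd₀ (Fin d) (by simp [hd]) (fun a ↦ {r | join e (fill a (V r)) y ∈ A})
      (fun a r ↦ by simp only [Set.mem_ofPred_eq, fill_subspace_fill])
      (fun r ↦ iverson (join e (V r) y ∈ A) - (c + ε))
      (fun r ↦ by linarith [iverson_le_one (join e (V r) y ∈ A)]) (fun d' hd' W ↦ ?_)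
    have := expect_lt_of_lineFree hfree hm (by simpa using hd') ((fixRight e y).comp (V.comp W))
    simp only [Subspace.comp_apply, fixRight_apply] at this
    rw [expect_sub_distrib, Fintype.expect_const]
    linarith
  have hlow : c - ε - (c + ε) ≤ 𝔼 r, 𝔼 y : ι₂ → Option α,
      (iverson (join e (V r) y ∈ A) - (c + ε)) := by
    refine le_expect univ_nonempty fun r _ ↦ ?_
    rw [expect_sub_distrib, Fintype.expect_const]
    linarith [hsec (V r)]
  have hup := hlow.trans (expect_le_expect fun r _ ↦ expect_le_expect fun y _ ↦ hpoint r y)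
  simp only [expect_sub_distrib, expect_add_distrib, Fintype.expect_const, ← mul_expect] at hup
  rw [expect_comm, expect_forall_ne_none, Fintype.card_fin] at hup
  have h1 := expect_le (s := univ) univ_nonempty fun y _ ↦ hcompl y
  have h2 : (Fintype.card α / (Fintype.card α + 1) : ℝ) ^ d ≤ c * θ / 4 :=
    (pow_le_pow_of_le_one hq0 hq1.le (le_max_right _ _)).trans hd₁.le
  have h3 := mul_le_mul_of_nonneg_left hV (show 0 ≤ c + ε by linarith)
  have h4 : c * θ ≤ (c + ε) * θ := by nlinarith
  have h5 : 0 < c * θ := by positivity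
  linarith

lemma isDHJ_unit : IsDHJ Unit := by
  intro δ hδ
  refine ⟨1, fun ι _ _ hι A hA ↦ ?_⟩
  obtain ⟨x, -, hx⟩ := exists_le_of_le_expect univ_nonempty hA
  have hxA : x ∈ A := by
    by_contra hxA
    rw [iverson_of_not hxA] at hx
    linarith
  have : Nonempty ι := Fintype.card_pos_iff.1 hι
  refine ⟨Line.diagonal Unit ι, fun a ↦ ?_⟩
  convert hxA

/-- The **density Hales–Jewett theorem**, for an alphabet of each positive size. -/
theorem exists_isDHJ (k : ℕ) :
    ∃ (α : Type) (_ : Fintype α) (_ : DecidableEq α), Fintype.card α = k + 1 ∧ IsDHJ α := by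
  induction k with
  | zero => exact ⟨Unit, inferInstance, inferInstance, rfl, isDHJ_unit⟩
  | succ k ih =>
    obtain ⟨α, _, _, hk, hα⟩ := ih
    have : Nonempty α := Fintype.card_pos_iff.1 (by omega)
    exact ⟨Option α, inferInstance, inferInstance, by simp [hk], hα.option⟩

end Induction

/-- If the alphabet `α` has the density Hales–Jewett property, then dense sets of integers contain
affine images of any `v : α → ℕ`. -/
lemma IsDHJ.exists_affine_image {α : Type} [Fintype α] [DecidableEq α] [Nonempty α]
    (hα : IsDHJ α) (v : α → ℕ) {k : ℕ} (hv : ∀ a, v a ≤ k) {δ : ℝ} (hδ : 0 < δ) :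
    ∃ N₀ : ℕ, ∀ N : ℕ, N₀ ≤ N → ∀ A ⊆ Finset.Icc (1 : ℤ) N, δ * N ≤ #A →
      ∃ a r : ℤ, 0 < r ∧ ∀ b, a + v b * r ∈ A := by
  classical
  obtain ⟨n, hn⟩ := hα (δ / 2) (by linarith)
  refine ⟨max 1 (n * k), fun N hN A hA hcard ↦ ?_⟩
  have hN1 : 1 ≤ N := (le_max_left _ _).trans hN
  have hnk : n * k ≤ N := (le_max_right _ _).trans hN
  let f : (Fin n → α) → ℤ := fun x ↦ ∑ i, (v (x i) : ℤ)
  have hf0 : ∀ x, 0 ≤ f x := fun x ↦ sum_nonneg fun _ _ ↦ by positivity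
  have hfk : ∀ x, f x ≤ n * k := fun x ↦ by
    have := sum_le_card_nsmul univ (fun i ↦ (v (x i) : ℤ)) k fun i _ ↦ by exact_mod_cast hv _
    simpa using this
  set S : Finset ℤ := Finset.Icc (1 - n * k : ℤ) N with hS
  have hScard : (#S : ℝ) = N + n * k := by
    have h : (#S : ℤ) = N + n * k := by
      rw [hS, Int.card_Icc, Int.toNat_of_nonneg (by nlinarith)]
      ring
    exact_mod_cast h
  have hS0 : S.Nonempty := ⟨1, by simp [hS, hN1]; positivity⟩
  have hcount : ∀ x, (#A : ℝ) ≤ ∑ s ∈ S, iverson (s + f x ∈ A) := by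
    intro x
    have hsub : A.image (fun t ↦ t - f x) ⊆ S.filter fun s ↦ s + f x ∈ A := by
      intro s hs
      obtain ⟨t, ht, rfl⟩ := Finset.mem_image.1 hs
      have := Finset.mem_Icc.1 (hA ht)
      have := hf0 x
      have := hfk x
      simp only [hS, Finset.mem_filter, Finset.mem_Icc, sub_add_cancel]
      exact ⟨⟨by linarith, by linarith⟩, ht⟩
    have := card_le_card hsub
    rw [card_image_of_injective _ (sub_left_injective (b := f x))] at this
    calc (#A : ℝ) ≤ #(S.filter fun s ↦ s + f x ∈ A) := by exact_mod_cast this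
      _ = ∑ s ∈ S, iverson (s + f x ∈ A) := by
        rw [card_filter, Nat.cast_sum]
        refine sum_congr rfl fun s _ ↦ ?_
        by_cases h : s + f x ∈ A <;> simp [iverson, h]
  have htotal : ∑ s ∈ S, δ / 2 ≤ ∑ s ∈ S, 𝔼 x, iverson (s + f x ∈ A) := by
    rw [← expect_sum_comm]
    refine le_expect univ_nonempty fun x _ ↦ le_trans ?_ (hcount x)
    rw [sum_const, nsmul_eq_mul, hScard]
    have : (n * k : ℝ) ≤ N := by exact_mod_cast hnk
    nlinarith
  obtain ⟨s, -, hs⟩ := exists_le_of_sum_le hS0 htotal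
  obtain ⟨l, hl⟩ := hn (Fin n) (by simp) {x | s + f x ∈ A} hs
  refine ⟨s + ∑ i, ((l.idxFun i).elim 0 v : ℕ), #{i | l.idxFun i = none}, ?_, fun b ↦ ?_⟩
  · obtain ⟨i, hi⟩ := l.proper
    exact_mod_cast card_pos.2 ⟨i, by simpa using hi⟩
  · have hb : f (l b) = ∑ i, (((l.idxFun i).elim 0 v : ℕ) : ℤ) +
        v b * #{i | l.idxFun i = none} := by
      rw [card_filter, Nat.cast_sum, mul_sum, ← sum_add_distrib]
      refine sum_congr rfl fun i _ ↦ ?_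
      cases h : l.idxFun i <;> simp [Line.coe_apply, h]
    have := hl b
    rw [Set.mem_ofPred_eq, hb, ← add_assoc] at this
    exact_mod_cast this

end DensityHalesJewett

/-- **Szemerédi's theorem.** For every `k ≥ 1` and `δ > 0` there is `N₀` such that for
all `N ≥ N₀`, every subset `A` of `[N] = {n : ℤ | 1 ≤ n ≤ N}` with `|A| ≥ δ N` contains
an arithmetic progression `a, a+r, …, a+(k-1)r` with `r` a positive integer. -/
theorem szemeredi_theorem (k : ℕ) (hk : 1 ≤ k) (δ : ℝ) (hδ : 0 < δ) :
    ∃ N₀ : ℕ, ∀ N : ℕ, N₀ ≤ N →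
      ∀ A ⊆ Finset.Icc (1 : ℤ) (N : ℤ), δ * (N : ℝ) ≤ (A.card : ℝ) →
        ∃ a : ℤ, ∃ r : ℤ, 0 < r ∧ ∀ i : ℕ, i < k → a + (i : ℤ) * r ∈ A := by
  obtain ⟨α, _, _, hcard, hα⟩ := DensityHalesJewett.exists_isDHJ (k - 1)
  have hcard : Fintype.card α = k := by omega
  have : Nonempty α := Fintype.card_pos_iff.1 (by omega)
  let e : α ≃ Fin k := Fintype.equivFinOfCardEq hcard
  obtain ⟨N₀, hN₀⟩ := hα.exists_affine_image (fun a ↦ (e a : ℕ))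
    (fun a ↦ (e a).isLt.le) hδ
  refine ⟨N₀, fun N hN A hA hAcard ↦ ?_⟩
  obtain ⟨a, r, hr, h⟩ := hN₀ N hN A hA hAcard
  refine ⟨a, r, hr, fun i hi ↦ ?_⟩
  simpa using h (e.symm ⟨i, hi⟩)
end

section
/- For every natural number d ≥ 1, every finite list v_1, …, v_k of elements of ℤ^d, and every δ > 0, there exists N_0 such that for all N ≥ N_0, every subset A of [N]^d with cardinality |A| ≥ δN^d contains a set of the form {a + r v_1, …, a + r v_k}, where a ∈ ℤ^d and r is a positive integer. -/
namespace DensityHalesJewett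

/-! ### Averages over finite types -/

/-- The average of a real function over a finite type. -/
noncomputable def avg {X : Type*} [Finite X] (f : X → ℝ) : ℝ :=
  letI := Fintype.ofFinite X
  (∑ x, f x) / Nat.card X

open Classical in
/-- The indicator of a proposition. -/
noncomputable def ind (p : Prop) : ℝ := if p then 1 else 0

lemma ind_of {p : Prop} (h : p) : ind p = 1 := by simp [ind, h]

lemma ind_of_not {p : Prop} (h : ¬ p) : ind p = 0 := by simp [ind, h]

lemma ind_nonneg (p : Prop) : 0 ≤ ind p := by
  unfold ind; split_ifs <;> norm_num

lemma ind_le_one (p : Prop) : ind p ≤ 1 := by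
  unfold ind; split_ifs <;> norm_num

lemma ind_mono {p q : Prop} (h : p → q) : ind p ≤ ind q := by
  by_cases hp : p
  · rw [ind_of hp, ind_of (h hp)]
  · rw [ind_of_not hp]; exact ind_nonneg q

section avg

variable {X Y : Type*} [Finite X] [Finite Y]

lemma avg_const [Nonempty X] (c : ℝ) : avg (fun _ : X => c) = c := by
  have h : (Nat.card X : ℝ) ≠ 0 := by exact_mod_cast Nat.card_pos.ne'
  let _ := Fintype.ofFinite X
  simp only [avg, Finset.sum_const, Finset.card_univ, nsmul_eq_mul, ← Nat.card_eq_fintype_card]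
  field_simp

lemma avg_add (f g : X → ℝ) : avg (fun x => f x + g x) = avg f + avg g := by
  simp [avg, Finset.sum_add_distrib, add_div]

lemma avg_sub (f g : X → ℝ) : avg (fun x => f x - g x) = avg f - avg g := by
  simp [avg, Finset.sum_sub_distrib, sub_div]

lemma avg_const_mul (c : ℝ) (f : X → ℝ) : avg (fun x => c * f x) = c * avg f := by
  simp [avg, ← Finset.mul_sum, mul_div_assoc]

lemma avg_mono {f g : X → ℝ} (h : ∀ x, f x ≤ g x) : avg f ≤ avg g := by
  unfold avg
  gcongr
  exact h _

lemma avg_congr {f g : X → ℝ} (h : ∀ x, f x = g x) : avg f = avg g :=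
  congrArg avg (funext h)

lemma avg_le [Nonempty X] {f : X → ℝ} {c : ℝ} (h : ∀ x, f x ≤ c) : avg f ≤ c :=
  (avg_mono h).trans_eq (avg_const c)

lemma le_avg [Nonempty X] {f : X → ℝ} {c : ℝ} (h : ∀ x, c ≤ f x) : c ≤ avg f :=
  (avg_const c).symm.trans_le (avg_mono h)

lemma avg_nonneg {f : X → ℝ} (h : ∀ x, 0 ≤ f x) : 0 ≤ avg f :=
  div_nonneg (Finset.sum_nonneg fun x _ => h x) (Nat.cast_nonneg _)

lemma exists_le_of_le_avg [Nonempty X] {f : X → ℝ} {c : ℝ} (h : c ≤ avg f) : ∃ x, c ≤ f x := by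
  obtain ⟨x, hx⟩ := Finite.exists_max f
  exact ⟨x, h.trans (avg_le hx)⟩

lemma avg_equiv (e : X ≃ Y) (f : Y → ℝ) : avg (fun x => f (e x)) = avg f := by
  unfold avg
  rw [Nat.card_congr e]
  congr 1
  let _ := Fintype.ofFinite X
  let _ := Fintype.ofFinite Y
  exact Fintype.sum_equiv e _ _ fun _ => rfl

lemma avg_prod (f : X × Y → ℝ) : avg f = avg fun x => avg fun y => f (x, y) := by
  let _ := Fintype.ofFinite X
  let _ := Fintype.ofFinite Y
  rw [avg, Subsingleton.elim (Fintype.ofFinite (X × Y)) (instFintypeProd X Y),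
    Fintype.sum_prod_type]
  simp only [avg, Nat.card_prod, ← Finset.sum_div, div_div, Nat.cast_mul]
  rw [mul_comm (Nat.card X : ℝ)]

lemma avg_comm (f : X → Y → ℝ) :
    (avg fun x => avg fun y => f x y) = avg fun y => avg fun x => f x y := by
  rw [← avg_prod (fun p : X × Y => f p.1 p.2), ← avg_prod (fun p : Y × X => f p.2 p.1)]
  exact avg_equiv (Equiv.prodComm X Y) (fun p : Y × X => f p.2 p.1)

lemma avg_sumElim {ι κ β : Type*} [Finite ι] [Finite κ] [Finite β] (f : (ι ⊕ κ → β) → ℝ) :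
    avg f = avg fun v => avg fun x => f (Sum.elim v x) := by
  rw [← avg_prod (fun p : (ι → β) × (κ → β) => f (Sum.elim p.1 p.2))]
  exact (avg_equiv (Equiv.sumArrowEquivProdArrow ι κ β).symm f).symm

lemma exists_le_avg_left {ι κ β : Type*} [Finite ι] [Finite κ] [Finite β] [Nonempty β]
    {f : (ι ⊕ κ → β) → ℝ} {c : ℝ} (h : c ≤ avg f) :
    ∃ y, c ≤ avg fun x => f (Sum.elim x y) := by
  rw [avg_sumElim, avg_comm] at h
  exact exists_le_of_le_avg h

lemma exists_le_avg_right {ι κ β : Type*} [Finite ι] [Finite κ] [Finite β] [Nonempty β]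
    {f : (ι ⊕ κ → β) → ℝ} {c : ℝ} (h : c ≤ avg f) :
    ∃ x, c ≤ avg fun y => f (Sum.elim x y) := by
  rw [avg_sumElim] at h
  exact exists_le_of_le_avg h

/-- Averaging over the range of an injection. -/
lemma avg_range [Nonempty X] {e : X → Y} (he : Function.Injective e) (h : Y → ℝ) :
    (avg fun y => ind (y ∈ Set.range e) * h y)
      = (Nat.card X / Nat.card Y : ℝ) * avg fun x => h (e x) := by
  classical
  let _ := Fintype.ofFinite X
  let _ := Fintype.ofFinite Y
  have hX : (Nat.card X : ℝ) ≠ 0 := by exact_mod_cast Nat.card_pos.ne'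
  have : ∑ y, ind (y ∈ Set.range e) * h y = ∑ x, h (e x) := by
    rw [← Finset.sum_image (s := Finset.univ) (g := e) (f := h) (fun a _ b _ hab => he hab)]
    simp only [ind, ite_mul, one_mul, zero_mul]
    rw [← Finset.sum_filter]
    congr 1
    ext y; simp
  simp only [avg]
  rw [this]
  field_simp

lemma ind_exists_le (P : X → Prop) : ind (∃ x, P x) ≤ Nat.card X * avg fun x => ind (P x) := by
  by_cases h : ∃ x, P x
  · obtain ⟨x, hx⟩ := h
    have : Nonempty X := ⟨x⟩
    have hX : (Nat.card X : ℝ) ≠ 0 := by exact_mod_cast Nat.card_pos.ne'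
    unfold avg
    rw [mul_div_cancel₀ _ hX]
    refine (ind_le_one _).trans ?_
    let _ := Fintype.ofFinite X
    rw [← ind_of hx]
    exact Finset.single_le_sum (f := fun x => ind (P x)) (fun i _ => ind_nonneg _)
      (Finset.mem_univ x)
  · rw [ind_of_not h]
    exact mul_nonneg (Nat.cast_nonneg _) (avg_nonneg fun _ => ind_nonneg _)

/-- If every dense fibre of `D` contains one of finitely many sets `Q v`, and `D` is dense, then
one of the `Q v` lies in a dense set of fibres of `D`. -/
lemma exists_dense_fibres {V : Type*} [Finite V] [Nonempty X] [Nonempty Y] {η : ℝ} (hη : 0 < η)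
    (Q : V → Set X) (D : X → Y → Prop)
    (hQ : ∀ y, η / 2 ≤ avg (fun x => ind (D x y)) → ∃ v, ∀ x ∈ Q v, D x y)
    (hD : η ≤ avg fun x => avg fun y => ind (D x y)) :
    ∃ v, η / 2 / (Nat.card V + 1) ≤ avg fun y => ind (∀ x ∈ Q v, D x y) := by
  have h1 : η / 2 ≤ avg fun y => ind (∃ v, ∀ x ∈ Q v, D x y) := by
    have h2 : ∀ y, (avg fun x => ind (D x y)) ≤ ind (∃ v, ∀ x ∈ Q v, D x y) + η / 2 := by
      intro y
      by_cases h : η / 2 ≤ avg fun x => ind (D x y)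
      · rw [ind_of (hQ y h)]
        have := avg_le (f := fun x => ind (D x y)) (c := 1) fun x => ind_le_one _
        linarith
      · have := ind_nonneg (∃ v, ∀ x ∈ Q v, D x y)
        linarith
    have h3 := avg_mono h2
    rw [avg_add, avg_const, avg_comm] at h3
    linarith
  have h2 : η / 2 ≤ Nat.card V * avg fun v => avg fun y => ind (∀ x ∈ Q v, D x y) := by
    refine h1.trans ((avg_mono fun y => ind_exists_le _).trans_eq ?_)
    rw [avg_const_mul, avg_comm]
  have hV : Nonempty V := by
    by_contra hV
    rw [not_nonempty_iff] at hV
    simp at h2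
    linarith
  have hV' : (0 : ℝ) < Nat.card V := by exact_mod_cast Nat.card_pos
  refine exists_le_of_le_avg ?_
  rw [div_le_iff₀ (by linarith), mul_add, mul_one, mul_comm]
  exact h2.trans (le_add_of_nonneg_right (avg_nonneg fun _ => avg_nonneg fun _ => ind_nonneg _))

end avg

/-! ### Combinatorial subspaces -/

section subspace

variable {α β η ζ ι κ : Type*}

/-- `e` parametrises a combinatorial subspace: each coordinate of `e x` is either constant or a
fixed coordinate of `x`, and each coordinate of `x` occurs. -/
def IsSubspace (e : (η → β) → (ι → β)) : Prop :=
  (∀ i, (∃ b, ∀ x, e x i = b) ∨ ∃ j, ∀ x, e x i = x j) ∧ ∀ j, ∃ i, ∀ x, e x i = x j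

/-- A combinatorial subspace over `Option α` whose constant coordinates are never `none`. -/
def IsRigid (e : (η → Option α) → (ι → Option α)) : Prop :=
  (∀ i, (∃ a, ∀ x, e x i = some a) ∨ ∃ j, ∀ x, e x i = x j) ∧ ∀ j, ∃ i, ∀ x, e x i = x j

/-- The set `A` contains a combinatorial line. -/
def HasLine (A : Set (ι → β)) : Prop :=
  ∃ e : (Unit → β) → (ι → β), IsSubspace e ∧ ∀ x, e x ∈ A

/-- Membership in `D` does not change when letters `none` and `some i` are interchanged. -/
def IsInsensitive (i : α) (D : Set (ι → Option α)) : Prop :=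
  ∀ x y, (∀ c, (x c).getD i = (y c).getD i) → x ∈ D → y ∈ D

lemma IsRigid.isSubspace {e : (η → Option α) → (ι → Option α)} (he : IsRigid e) :
    IsSubspace e :=
  ⟨fun i => (he.1 i).imp (fun ⟨a, ha⟩ => ⟨some a, ha⟩) id, he.2⟩

lemma IsSubspace.comp {e : (η → β) → (ι → β)} {f : (ζ → β) → (η → β)} (he : IsSubspace e)
    (hf : IsSubspace f) : IsSubspace fun x => e (f x) := by
  refine ⟨fun i => ?_, fun j => ?_⟩
  · obtain ⟨b, hb⟩ | ⟨j, hj⟩ := he.1 i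
    · exact .inl ⟨b, fun x => hb _⟩
    · obtain ⟨b, hb⟩ | ⟨k, hk⟩ := hf.1 j
      · exact .inl ⟨b, fun x => (hj _).trans (hb x)⟩
      · exact .inr ⟨k, fun x => (hj _).trans (hk x)⟩
  · obtain ⟨k, hk⟩ := hf.2 j
    obtain ⟨i, hi⟩ := he.2 k
    exact ⟨i, fun x => (hi _).trans (hk x)⟩

lemma IsRigid.comp {e : (η → Option α) → (ι → Option α)} {f : (ζ → Option α) → (η → Option α)}
    (he : IsRigid e) (hf : IsRigid f) : IsRigid fun x => e (f x) := by
  refine ⟨fun i => ?_, (he.isSubspace.comp hf.isSubspace).2⟩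
  obtain ⟨b, hb⟩ | ⟨j, hj⟩ := he.1 i
  · exact .inl ⟨b, fun x => hb _⟩
  · obtain ⟨b, hb⟩ | ⟨k, hk⟩ := hf.1 j
    · exact .inl ⟨b, fun x => (hj _).trans (hb x)⟩
    · exact .inr ⟨k, fun x => (hj _).trans (hk x)⟩

lemma IsSubspace.injective {e : (η → β) → (ι → β)} (he : IsSubspace e) :
    Function.Injective e := by
  intro x y hxy
  funext j
  obtain ⟨i, hi⟩ := he.2 j
  rw [← hi x, ← hi y, hxy]

lemma IsSubspace.elim_right {e : (η → β) → (ι → β)} (he : IsSubspace e) (y : κ → β) :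
    IsSubspace fun x => Sum.elim (e x) y := by
  refine ⟨?_, fun j => ?_⟩
  · rintro (i | i)
    · exact he.1 i
    · exact .inl ⟨y i, fun x => rfl⟩
  · obtain ⟨i, hi⟩ := he.2 j
    exact ⟨.inl i, hi⟩

lemma IsSubspace.elim_left {e : (η → β) → (ι → β)} (he : IsSubspace e) (y : κ → β) :
    IsSubspace fun x => Sum.elim y (e x) := by
  refine ⟨?_, fun j => ?_⟩
  · rintro (i | i)
    · exact .inl ⟨y i, fun x => rfl⟩
    · exact he.1 i
  · obtain ⟨i, hi⟩ := he.2 j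
    exact ⟨.inr i, hi⟩

lemma isSubspace_id : IsSubspace (fun x : η → β => x) :=
  ⟨fun i => .inr ⟨i, fun _ => rfl⟩, fun j => ⟨j, fun _ => rfl⟩⟩

lemma isRigid_id : IsRigid (fun x : η → Option α => x) :=
  ⟨fun i => .inr ⟨i, fun _ => rfl⟩, fun j => ⟨j, fun _ => rfl⟩⟩

lemma isRigid_reindex (e : ι ≃ η) : IsRigid (fun (x : η → Option α) i => x (e i)) :=
  ⟨fun i => .inr ⟨e i, fun _ => rfl⟩, fun j => ⟨e.symm j, fun x => by simp⟩⟩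

lemma isSubspace_reindex (e : ι ≃ η) : IsSubspace (fun (x : η → β) i => x (e i)) :=
  ⟨fun i => .inr ⟨e i, fun _ => rfl⟩, fun j => ⟨e.symm j, fun x => by simp⟩⟩

/-- The product of two combinatorial subspaces. -/
lemma IsSubspace.prod {e : (η → β) → (ι → β)} {f : (ζ → β) → (κ → β)} (he : IsSubspace e)
    (hf : IsSubspace f) :
    IsSubspace fun x : η ⊕ ζ → β =>
      Sum.elim (e fun i => x (.inl i)) (f fun i => x (.inr i)) := by
  refine ⟨?_, ?_⟩
  · rintro (i | i)
    · exact (he.1 i).imp (fun ⟨b, hb⟩ => ⟨b, fun x => hb _⟩) fun ⟨j, hj⟩ => ⟨.inl j, fun x => hj _⟩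
    · exact (hf.1 i).imp (fun ⟨b, hb⟩ => ⟨b, fun x => hb _⟩) fun ⟨j, hj⟩ => ⟨.inr j, fun x => hj _⟩
  · rintro (j | j)
    · exact (he.2 j).imp' Sum.inl fun i hi x => hi _
    · exact (hf.2 j).imp' Sum.inr fun i hi x => hi _

lemma HasLine.of_preimage {e : (η → β) → (ι → β)} (he : IsSubspace e) {A : Set (ι → β)}
    (h : HasLine (e ⁻¹' A)) : HasLine A := by
  obtain ⟨l, hl, hA⟩ := h
  exact ⟨_, he.comp hl, hA⟩

lemma IsInsensitive.preimage {e : (η → Option α) → (ι → Option α)} (he : IsSubspace e) {i : α}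
    {D : Set (ι → Option α)} (hD : IsInsensitive i D) : IsInsensitive i (e ⁻¹' D) := by
  intro x y hxy
  refine hD _ _ fun c => ?_
  obtain ⟨b, hb⟩ | ⟨j, hj⟩ := he.1 c
  · rw [hb, hb]
  · rw [hj, hj, hxy]

lemma IsInsensitive.compl {i : α} {D : Set (ι → Option α)} (hD : IsInsensitive i D) :
    IsInsensitive i Dᶜ :=
  fun x y hxy hx hy => hx (hD y x (fun c => (hxy c).symm) hy)

/-- Rigid subspaces commute with substituting a letter for `none`. -/
lemma IsRigid.map_subst {e : (η → Option α) → (ι → Option α)} (he : IsRigid e)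
    (b : Option α) (x : η → Option α) (i : ι) :
    e (fun j => (x j).elim b some) i = (e x i).elim b some := by
  obtain ⟨a, ha⟩ | ⟨j, hj⟩ := he.1 i
  · rw [ha, ha]; rfl
  · rw [hj, hj]

/-- A word containing `none`, read as a line. -/
lemma isSubspace_subst {w : ι → Option β} (hw : ∃ i, w i = none) :
    IsSubspace fun (x : Unit → β) i => (w i).elim (x ()) id := by
  refine ⟨fun i => ?_, fun j => ?_⟩
  · cases h : w i with
    | none => exact .inr ⟨(), fun x => by simp [h]⟩
    | some b => exact .inl ⟨b, fun x => by simp [h]⟩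
  · obtain ⟨i, hi⟩ := hw
    exact ⟨i, fun x => by simp [hi]⟩

/-- A line, read as a word containing `none`. -/
lemma IsSubspace.exists_word {e : (Unit → β) → (ι → β)} (he : IsSubspace e) :
    ∃ w : ι → Option β, (∃ i, w i = none) ∧ ∀ x i, e x i = (w i).elim (x ()) id := by
  classical
  obtain ⟨i₀, hi₀⟩ := he.2 ()
  have : ∀ i, ∃ o : Option β, (i = i₀ → o = none) ∧ ∀ x, e x i = o.elim (x ()) id := by
    intro i
    by_cases h : i = i₀
    · exact ⟨none, fun _ => rfl, fun x => by rw [h, hi₀]; rfl⟩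
    · obtain ⟨b, hb⟩ | ⟨j, hj⟩ := he.1 i
      · exact ⟨some b, fun h' => absurd h' h, fun x => hb x⟩
      · exact ⟨none, fun _ => rfl, fun x => by rw [hj]; rfl⟩
  choose w hw using this
  exact ⟨w, ⟨i₀, (hw i₀).1 rfl⟩, fun x i => (hw i).2 x⟩

end subspace

/-! ### Subspaces in dense insensitive sets -/

section insensitive

/-- The density Hales-Jewett property of the alphabet `α`. -/
def DHJ (α : Type) [Finite α] : Prop :=
  ∀ δ : ℝ, 0 < δ → ∃ (ι : Type) (_ : Finite ι), ∀ A : Set (ι → α),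
    δ ≤ avg (fun x => ind (x ∈ A)) → HasLine A

lemma induction_sum_unit {P : Type → Prop} (of_equiv : ∀ {α β : Type}, α ≃ β → P α → P β)
    (empty : P PEmpty) (sum_unit : ∀ {α : Type} [Finite α], P α → P (α ⊕ Unit))
    (α : Type) [Finite α] : P α :=
  Finite.induction_empty_option (P := P) of_equiv empty
    (fun {α} _ h => of_equiv (Equiv.optionEquivSumPUnit α).symm (sum_unit h)) α

variable {α : Type} [Finite α]

lemma avg_unit_option [Nonempty α] (g : (Unit → Option α) → ℝ) :
    avg g = (Nat.card α * (avg fun a : Unit → α => g fun u => some (a u)) + g fun _ => none)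
      / (Nat.card α + 1) := by
  have hα : (Nat.card α : ℝ) ≠ 0 := by exact_mod_cast Nat.card_pos.ne'
  rw [← avg_equiv (Equiv.funUnique Unit (Option α)).symm,
    ← avg_equiv (Equiv.funUnique Unit α).symm]
  let _ := Fintype.ofFinite α
  rw [avg, Subsingleton.elim (Fintype.ofFinite (Option α)) instFintypeOption, Fintype.sum_option,
    avg, mul_div_cancel₀ _ hα, add_comm]
  have : (Nat.card (Option α) : ℝ) = Nat.card α + 1 := by
    rw [Finite.card_option]; push_cast; rfl
  rw [this]
  rfl

/-- A bounded function on words over `Option α` correlates with a line having most of the average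
on its points in `α`. -/
lemma exists_line_avg_le [Nonempty α] (L : ℕ) : ∃ (ι : Type) (_ : Finite ι),
    ∀ f : (ι → Option α) → ℝ, (∀ x, 0 ≤ f x) → (∀ x, f x ≤ 1) →
      ∃ e : (Unit → Option α) → (ι → Option α), IsSubspace e ∧
        avg f ≤ (avg fun x : Unit → α => f (e fun u => some (x u)))
          + (1 / (Nat.card α + 1) : ℝ) ^ L := by
  induction L with
  | zero =>
    refine ⟨Unit, inferInstance, fun f h0 h1 => ⟨fun x => x, isSubspace_id, ?_⟩⟩
    have h2 := avg_le h1
    have h3 := avg_nonneg fun x : Unit → α => h0 fun u => some (x u)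
    rw [pow_zero]
    linarith
  | succ L ih =>
    obtain ⟨ι, _, h⟩ := ih
    refine ⟨Unit ⊕ ι, inferInstance, fun f h0 h1 => ?_⟩
    obtain ⟨e, he, hle⟩ := h (fun z => f (Sum.elim (fun _ => none) z)) (fun _ => h0 _)
      (fun _ => h1 _)
    obtain ⟨z, hz⟩ := exists_le_of_le_avg
      (f := fun z : ι → Option α => avg fun a : Unit → α => f (Sum.elim (fun u => some (a u)) z))
      le_rfl
    have key := avg_sumElim f
    rw [avg_unit_option, avg_comm] at key
    set q : ℝ := (1 / (Nat.card α + 1) : ℝ) with hq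
    set k : ℝ := (Nat.card α : ℝ)
    have hk : 0 ≤ k := Nat.cast_nonneg _
    set s₁ := avg fun x : Unit → α => f (Sum.elim (fun _ => none) (e fun u => some (x u)))
    set s₂ := avg fun a : Unit → α => f (Sum.elim (fun u => some (a u)) z)
    have hle' : ∀ s, s₁ ≤ s → s₂ ≤ s → avg f ≤ s + q ^ (L + 1) := by
      intro s hs₁ hs₂
      rw [key, div_le_iff₀ (by positivity), pow_succ]
      have : q * (k + 1) = 1 := by rw [hq]; field_simp
      have h4 := mul_le_mul_of_nonneg_left (hz.trans hs₂) hk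
      have h5 : (s + q ^ L * q) * (k + 1) = k * s + s + q ^ L := by
        linear_combination q ^ L * this
      rw [h5]
      linarith
    rcases le_total s₁ s₂ with hs | hs
    · exact ⟨_, isSubspace_id.elim_right z, hle' s₂ hs le_rfl⟩
    · exact ⟨_, he.elim_left _, hle' s₁ le_rfl hs⟩

/-- A multidimensional version of `exists_line_avg_le`. -/
lemma exists_subspace_avg_le [Nonempty α] (M : Type) [Finite M] : ∀ ε : ℝ, 0 < ε →
    ∃ (ι : Type) (_ : Finite ι), ∀ f : (ι → Option α) → ℝ, (∀ x, 0 ≤ f x) → (∀ x, f x ≤ 1) →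
      ∃ e : (M → Option α) → (ι → Option α), IsSubspace e ∧
        ∃ _ : Finite M, avg f ≤ (avg fun x : M → α => f (e fun u => some (x u))) + ε := by
  induction M using induction_sum_unit with
  | @of_equiv M M' σ ih =>
    intro ε hε
    obtain ⟨ι, hι, h⟩ := ih ε hε
    refine ⟨ι, hι, fun f h0 h1 => ?_⟩
    obtain ⟨e, he, hM, hle⟩ := h f h0 h1
    have hM' : Finite M' := Finite.of_equiv M σ
    refine ⟨_, he.comp (isSubspace_reindex σ), hM', hle.trans_eq ?_⟩
    rw [← avg_equiv (Equiv.arrowCongr σ.symm (Equiv.refl α))]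
    rfl
  | empty =>
    intro ε hε
    refine ⟨PEmpty, inferInstance, fun f h0 h1 => ⟨_, isSubspace_id, inferInstance, ?_⟩⟩
    rw [avg_congr (f := f) (g := fun _ => f PEmpty.elim) fun x => by
        rw [Subsingleton.elim x PEmpty.elim], avg_const,
      avg_congr (g := fun _ => f PEmpty.elim) fun x => by
        rw [Subsingleton.elim (fun u => some (x u)) PEmpty.elim], avg_const]
    linarith
  | @sum_unit M _ ih =>
    intro ε hε
    obtain ⟨ι₁, _, h₁⟩ := ih (ε / 2) (by linarith)
    obtain ⟨L, hL⟩ := exists_pow_lt_of_lt_one (show 0 < ε / 2 by linarith)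
      (show (1 / (Nat.card α + 1) : ℝ) < 1 by
        have : (0 : ℝ) < Nat.card α := by exact_mod_cast Nat.card_pos
        rw [div_lt_one (by linarith)]
        linarith)
    obtain ⟨ι₂, _, h₂⟩ := exists_line_avg_le (α := α) L
    refine ⟨ι₁ ⊕ ι₂, inferInstance, fun f h0 h1 => ?_⟩
    obtain ⟨e₁, he₁, _, hle₁⟩ := h₁ (fun y => avg fun z => f (Sum.elim y z))
      (fun y => avg_nonneg fun _ => h0 _) (fun y => avg_le fun _ => h1 _)
    obtain ⟨e₂, he₂, hle₂⟩ := h₂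
      (fun z => avg fun x : M → α => f (Sum.elim (e₁ fun u => some (x u)) z))
      (fun y => avg_nonneg fun _ => h0 _) (fun y => avg_le fun _ => h1 _)
    refine ⟨_, he₁.prod he₂, inferInstance, ?_⟩
    rw [avg_sumElim, avg_sumElim (ι := M), avg_comm (X := M → α)]
    rw [avg_comm] at hle₂
    simp only [Sum.elim_inl, Sum.elim_inr] at hle₁ hle₂ ⊢
    linarith

/-- Dense insensitive sets contain lines. -/
lemma exists_hasLine_of_insensitive [Nonempty α] (hα : DHJ α) (i : α) {η : ℝ} (hη : 0 < η) :
    ∃ (ι : Type) (_ : Finite ι), ∀ D : Set (ι → Option α), IsInsensitive i D →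
      η ≤ avg (fun x => ind (x ∈ D)) → HasLine D := by
  obtain ⟨M, _, hM⟩ := hα (η / 2) (by linarith)
  obtain ⟨ι, hι, h⟩ := exists_subspace_avg_le (α := α) M (η / 2) (by linarith)
  refine ⟨ι, hι, fun D hD hd => ?_⟩
  obtain ⟨e, he, _, hle⟩ := h (fun x => ind (x ∈ D)) (fun _ => ind_nonneg _)
    (fun _ => ind_le_one _)
  obtain ⟨l, hl, hlD⟩ := hM {x | e (fun u => some (x u)) ∈ D} (by
    simp only [Set.mem_ofPred_eq]; linarith)
  obtain ⟨w, hw, hlw⟩ := hl.exists_word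
  refine HasLine.of_preimage he ⟨_, isSubspace_subst (w := fun j => (w j).map some)
    (hw.imp fun j hj => by simp [hj]), fun x => ?_⟩
  refine hD.preimage he (fun j => some (l (fun _ => (x ()).getD i) j)) _ (fun c => ?_) (hlD _)
  rw [hlw]
  cases w c <;> simp

/-- Dense insensitive sets contain subspaces. -/
lemma exists_subspace_of_insensitive [Nonempty α] (hα : DHJ α) (i : α) (ζ : Type) [Finite ζ] :
    ∀ η : ℝ, 0 < η → ∃ (ι : Type) (_ : Finite ι), ∀ D : Set (ι → Option α), IsInsensitive i D →
      η ≤ avg (fun x => ind (x ∈ D)) →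
        ∃ e : (ζ → Option α) → (ι → Option α), IsSubspace e ∧ ∀ x, e x ∈ D := by
  induction ζ using induction_sum_unit with
  | @of_equiv M M' σ ih =>
    intro η hη
    obtain ⟨ι, hι, h⟩ := ih η hη
    refine ⟨ι, hι, fun D hD hd => ?_⟩
    obtain ⟨e, he, hle⟩ := h D hD hd
    exact ⟨_, he.comp (isSubspace_reindex σ), fun x => hle _⟩
  | empty =>
    intro η hη
    refine ⟨PEmpty, inferInstance, fun D hD hd => ⟨_, isSubspace_id, fun x => ?_⟩⟩
    obtain ⟨y, hy⟩ := exists_le_of_le_avg hd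
    by_contra hx
    rw [Subsingleton.elim y x, ind_of_not hx] at hy
    linarith
  | @sum_unit ζ _ ih =>
    intro η hη
    obtain ⟨ι₁, _, h₁⟩ := ih (η / 2) (by linarith)
    let V := {e : (ζ → Option α) → (ι₁ → Option α) // IsSubspace e}
    obtain ⟨ι₂, _, h₂⟩ := exists_hasLine_of_insensitive hα i
      (show 0 < η / 2 / (Nat.card V + 1) by positivity)
    refine ⟨ι₁ ⊕ ι₂, inferInstance, fun D hD hd => ?_⟩
    rw [avg_sumElim] at hd
    obtain ⟨⟨e₁, he₁⟩, hd₁⟩ := exists_dense_fibres hη (fun v : V => Set.range v.1)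
      (fun x y => Sum.elim x y ∈ D) (fun y hy => by
        obtain ⟨e, he, heD⟩ := h₁ {x | Sum.elim x y ∈ D}
          (hD.preimage (isSubspace_id.elim_right y)) hy
        exact ⟨⟨e, he⟩, by rintro _ ⟨x, rfl⟩; exact heD x⟩) hd
    obtain ⟨e₂, he₂, heD⟩ := h₂ {y | ∀ x ∈ Set.range e₁, Sum.elim x y ∈ D}
      (fun y y' hy hyD x hx => hD.preimage (isSubspace_id.elim_left x) y y' hy (hyD x hx)) hd₁
    exact ⟨_, he₁.prod he₂, fun x => heD _ _ ⟨_, rfl⟩⟩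

/-- If `g` has small average on every subspace, then it has small average on every insensitive
set, by greedily removing subspaces from it. -/
lemma exists_avg_insensitive_le [Nonempty α] (hα : DHJ α) (i : α) (ζ : Type) [Finite ζ] {η : ℝ}
    (hη : 0 < η) : ∃ q : ℝ, 0 ≤ q ∧ q < 1 ∧ ∀ t : ℕ, ∃ (ι : Type) (_ : Finite ι),
      ∀ (g : (ι → Option α) → ℝ) (D : Set (ι → Option α)), (∀ x, g x ≤ 1) → IsInsensitive i D →
        (∀ e : (ζ → Option α) → (ι → Option α), IsSubspace e → avg (fun x => g (e x)) ≤ η) →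
          avg (fun x => ind (x ∈ D) * g x) ≤
            η * avg (fun x => ind (x ∈ D)) + η + q ^ t * (avg (fun x => ind (x ∈ D)) - η) := by
  obtain ⟨ι₁, _, h₁⟩ := exists_subspace_of_insensitive hα i ζ (η / 2) (by linarith)
  let V := {e : (ζ → Option α) → (ι₁ → Option α) // IsSubspace e}
  set r : ℝ := (Nat.card (ζ → Option α) : ℝ) / Nat.card (ι₁ → Option α) with hr
  have hr0 : 0 < r := by
    have h2 : (0 : ℝ) < Nat.card (ζ → Option α) := by exact_mod_cast Nat.card_pos
    have h3 : (0 : ℝ) < Nat.card (ι₁ → Option α) := by exact_mod_cast Nat.card_pos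
    positivity
  set θ : ℝ := min (r * (η / 2 / (Nat.card V + 1))) (1 / 2) with hθ
  have hθ0 : 0 < θ := by positivity
  have hθ1 : θ ≤ 1 / 2 := min_le_right _ _
  have hθ2 : θ ≤ r * (η / 2 / (Nat.card V + 1)) := min_le_left _ _
  refine ⟨1 - θ, by linarith, by linarith, fun t => ?_⟩
  have hsmall : ∀ {ι : Type} [Finite ι] (g : (ι → Option α) → ℝ) (D : Set (ι → Option α)),
      (∀ x, g x ≤ 1) → avg (fun x => ind (x ∈ D) * g x) ≤ avg (fun x => ind (x ∈ D)) :=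
    fun g D hg => avg_mono fun x => mul_le_of_le_one_right (ind_nonneg _) (hg x)
  induction t with
  | zero =>
    refine ⟨ι₁, inferInstance, fun g D hg _ _ => (hsmall g D hg).trans ?_⟩
    have := avg_nonneg fun x : ι₁ → Option α => ind_nonneg (x ∈ D)
    have := mul_nonneg hη.le this
    rw [pow_zero]
    linarith
  | succ t ih =>
    obtain ⟨ι₂, _, h₂⟩ := ih
    refine ⟨ι₁ ⊕ ι₂, inferInstance, fun g D hg hD hge => ?_⟩
    set d := avg (fun x => ind (x ∈ D)) with hd
    have hd0 : 0 ≤ d := avg_nonneg fun x => ind_nonneg _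
    have hd1 : d ≤ 1 := avg_le fun x => ind_le_one _
    have hq0 : (0 : ℝ) ≤ (1 - θ) ^ t := pow_nonneg (by linarith) _
    rcases le_total d η with hdη | hdη
    · refine (hsmall g D hg).trans ?_
      have hq1 : (1 - θ) ^ (t + 1) ≤ 1 := pow_le_one₀ (by linarith) (by linarith)
      have := mul_nonneg (sub_nonneg.2 hq1) (sub_nonneg.2 hdη)
      have := mul_nonneg hη.le hd0
      linarith
    · obtain ⟨⟨e, he⟩, hX⟩ := exists_dense_fibres hη (fun v : V => Set.range v.1)
        (fun x y => Sum.elim x y ∈ D) (fun y hy => by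
          obtain ⟨e, he, heD⟩ := h₁ {x | Sum.elim x y ∈ D}
            (hD.preimage (isSubspace_id.elim_right y)) hy
          exact ⟨⟨e, he⟩, by rintro _ ⟨x, rfl⟩; exact heD x⟩) (by rwa [hd, avg_sumElim] at hdη)
      set X : Set (ι₂ → Option α) := {y | ∀ x ∈ Set.range e, Sum.elim x y ∈ D} with hXdef
      set ρ := r * avg (fun y => ind (y ∈ X)) with hρ
      have hρθ : θ ≤ ρ := hθ2.trans (mul_le_mul_of_nonneg_left hX hr0.le)
      let D' : (ι₁ → Option α) → Set (ι₂ → Option α) :=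
        fun v => {y | Sum.elim v y ∈ D ∧ ¬ (v ∈ Set.range e ∧ y ∈ X)}
      have hXins : IsInsensitive i X := fun y y' hy hyD x hx =>
        hD.preimage (isSubspace_id.elim_left x) y y' hy (hyD x hx)
      have hD' : ∀ v, IsInsensitive i (D' v) := fun v y y' hy hyD =>
        ⟨hD.preimage (isSubspace_id.elim_left v) y y' hy hyD.1,
          fun h => hyD.2 ⟨h.1, hXins y' y (fun c => (hy c).symm) h.2⟩⟩
      have hsplit : ∀ v y, ind (Sum.elim v y ∈ D) =
          ind (v ∈ Set.range e) * ind (y ∈ X) + ind (y ∈ D' v) := by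
        intro v y
        by_cases hv : v ∈ Set.range e
        · by_cases hy : y ∈ X
          · rw [ind_of hv, ind_of hy, ind_of (hy v hv), ind_of_not fun h => h.2 ⟨hv, hy⟩]
            norm_num
          · rw [ind_of_not hy, mul_zero, zero_add]
            exact congrArg ind (propext ⟨fun h => ⟨h, fun h => hy h.2⟩, fun h => h.1⟩)
        · rw [ind_of_not hv, zero_mul, zero_add]
          exact congrArg ind (propext ⟨fun h => ⟨h, fun h => hv h.1⟩, fun h => h.1⟩)
      have hdsplit : d = ρ + avg fun v => avg fun y => ind (y ∈ D' v) := by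
        rw [hd, avg_sumElim]
        simp only [hsplit, avg_add, avg_const_mul]
        congr 1
        rw [avg_range he.injective, avg_const]
      have hgsplit : avg (fun x => ind (x ∈ D) * g x) =
          r * (avg fun y => ind (y ∈ X) * avg fun w => g (Sum.elim (e w) y)) +
            avg fun v => avg fun y => ind (y ∈ D' v) * g (Sum.elim v y) := by
        rw [avg_sumElim]
        simp only [hsplit, add_mul, avg_add]
        congr 1
        simp only [mul_assoc, avg_const_mul]
        rw [avg_range he.injective
          (fun v => avg fun y => ind (y ∈ X) * g (Sum.elim v y)), avg_comm]
        simp only [avg_const_mul, hr]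
      have hb₁ : (avg fun y => ind (y ∈ X) * avg fun w => g (Sum.elim (e w) y)) ≤
          avg fun y => η * ind (y ∈ X) := by
        refine avg_mono fun y => ?_
        rw [mul_comm]
        exact mul_le_mul_of_nonneg_right (hge _ (he.elim_right y)) (ind_nonneg _)
      have hb₂ := avg_mono fun v => h₂ (fun y => g (Sum.elim v y)) (D' v) (fun _ => hg _) (hD' v)
        fun f hf => hge _ (hf.elim_left v)
      simp only [avg_add, avg_const_mul, avg_sub, avg_const] at hb₁ hb₂
      rw [hgsplit]
      set d' := avg fun v => avg fun y => ind (y ∈ D' v) with hd'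
      have h4 := mul_le_mul_of_nonneg_left hb₁ hr0.le
      have h5 : d' - η ≤ (1 - θ) * (d - η) := by nlinarith
      have h6 := mul_le_mul_of_nonneg_left h5 hq0
      have h7 : r * (η * avg fun y => ind (y ∈ X)) = η * ρ := by rw [hρ]; ring
      rw [hdsplit] at h6 ⊢
      rw [pow_succ]
      linarith

/-- A bounded function having positive correlation with an insensitive set has positive average
on some subspace. -/
lemma exists_subspace_of_le_avg_insensitive [Nonempty α] (hα : DHJ α) (i : α) (ζ : Type)
    [Finite ζ] {ε : ℝ} (hε : 0 < ε) : ∃ (ι : Type) (_ : Finite ι),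
      ∀ (g : (ι → Option α) → ℝ) (D : Set (ι → Option α)), (∀ x, g x ≤ 1) → IsInsensitive i D →
        ε ≤ avg (fun x => ind (x ∈ D) * g x) →
          ∃ e : (ζ → Option α) → (ι → Option α), IsSubspace e ∧
            ε / 4 ≤ avg (fun x => g (e x)) := by
  obtain ⟨q, hq0, hq1, h⟩ :=
    exists_avg_insensitive_le hα i ζ (show 0 < ε / 4 by linarith)
  obtain ⟨t, ht⟩ := exists_pow_lt_of_lt_one (show 0 < ε / 4 by linarith) hq1
  obtain ⟨ι, hι, h⟩ := h t
  refine ⟨ι, hι, fun g D hg hD hgD => ?_⟩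
  by_contra! hcon
  have h1 := h g D hg hD fun e he => (hcon e he).le
  have hd1 : avg (fun x => ind (x ∈ D)) ≤ 1 := avg_le fun x => ind_le_one _
  have hd0 : 0 ≤ avg (fun x => ind (x ∈ D)) := avg_nonneg fun x => ind_nonneg _
  have hqt : 0 ≤ q ^ t := pow_nonneg hq0 t
  nlinarith

/-- A bounded function having positive correlation with the complement of an intersection of
insensitive sets has nonnegative average on some subspace. -/
lemma exists_subspace_of_le_avg_compl [Nonempty α] (hα : DHJ α) (ζ : Type) [Finite ζ]
    (s : Finset α) : ∀ ε : ℝ, 0 < ε → ∃ (ι : Type) (_ : Finite ι),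
      ∀ (f : (ι → Option α) → ℝ) (D : α → Set (ι → Option α)), (∀ x, f x ≤ 1) →
        (∀ i, IsInsensitive i (D i)) → ε ≤ avg (fun x => ind (¬ ∀ i ∈ s, x ∈ D i) * f x) →
          ∃ e : (ζ → Option α) → (ι → Option α), IsSubspace e ∧ 0 ≤ avg (fun x => f (e x)) := by
  classical
  induction s using Finset.induction_on with
  | empty =>
    intro ε hε
    refine ⟨ζ, inferInstance, fun f D _ _ h => ⟨_, isSubspace_id, ?_⟩⟩
    simp only [Finset.notMem_empty, IsEmpty.forall_iff, implies_true, not_true_eq_false,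
      ind_of_not not_false, zero_mul, avg_const] at h
    linarith
  | insert a s _ ih =>
    intro ε hε
    obtain ⟨ι', _, h⟩ := ih (ε / 8) (by linarith)
    obtain ⟨ι, hι, h'⟩ := exists_subspace_of_le_avg_insensitive hα a (ι' ⊕ ζ)
      (show 0 < ε / 2 by linarith)
    refine ⟨ι, hι, fun f D hf hD hε' => ?_⟩
    have hsplit : ∀ x, ind (¬ ∀ i ∈ insert a s, x ∈ D i) * f x =
        ind (x ∈ (D a)ᶜ) * f x + ind (x ∈ D a) * (ind (¬ ∀ i ∈ s, x ∈ D i) * f x) := by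
      intro x
      by_cases hx : x ∈ D a
      · rw [ind_of hx, ind_of_not (p := x ∈ (D a)ᶜ) (fun h => h hx)]
        simp [hx]
      · rw [ind_of_not hx, ind_of (p := x ∈ (D a)ᶜ) hx, ind_of (by simp [hx])]
        ring
    simp only [hsplit, avg_add] at hε'
    rcases le_total (ε / 2) (avg fun x => ind (x ∈ (D a)ᶜ) * f x) with hc | hc
    · obtain ⟨e, he, hle⟩ := h' f _ hf (hD a).compl hc
      obtain ⟨y, hy⟩ := exists_le_avg_right hle
      exact ⟨_, he.comp (isSubspace_id.elim_left y), by linarith⟩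
    · obtain ⟨e, he, hle⟩ := h' (fun x => ind (¬ ∀ i ∈ s, x ∈ D i) * f x) _ (fun x => by
        nlinarith [hf x, ind_nonneg (¬ ∀ i ∈ s, x ∈ D i), ind_le_one (¬ ∀ i ∈ s, x ∈ D i)])
        (hD a) (by linarith)
      obtain ⟨y, hy⟩ := exists_le_avg_left hle
      have he' := he.comp (isSubspace_id.elim_right y)
      obtain ⟨e', he'', hle'⟩ := h (fun x => f (e (Sum.elim x y)))
        (fun i => (fun x => e (Sum.elim x y)) ⁻¹' D i) (fun _ => hf _)
        (fun i => (hD i).preimage he') (le_trans (by linarith) hy)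
      exact ⟨_, he'.comp he'', hle'⟩

end insensitive

/-! ### Lines avoiding the letter `none` outside their wildcards -/

section graham_rothschild

lemma IsRigid.prod {α η ζ ι κ : Type*} {e : (η → Option α) → (ι → Option α)}
    {f : (ζ → Option α) → (κ → Option α)} (he : IsRigid e) (hf : IsRigid f) :
    IsRigid fun x : η ⊕ ζ → Option α =>
      Sum.elim (e fun i => x (.inl i)) (f fun i => x (.inr i)) := by
  refine ⟨?_, (he.isSubspace.prod hf.isSubspace).2⟩
  rintro (i | i)
  · exact (he.1 i).imp (fun ⟨b, hb⟩ => ⟨b, fun x => hb _⟩) fun ⟨j, hj⟩ => ⟨.inl j, fun x => hj _⟩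
  · exact (hf.1 i).imp (fun ⟨b, hb⟩ => ⟨b, fun x => hb _⟩) fun ⟨j, hj⟩ => ⟨.inr j, fun x => hj _⟩

/-- A word containing `none`, read as a line over a larger alphabet. -/
lemma isRigid_subst {α ι : Type*} {w : ι → Option α} (hw : ∃ i, w i = none) :
    IsRigid fun (x : Unit → Option α) i => (w i).elim (x ()) some := by
  refine ⟨fun i => ?_, fun j => ?_⟩
  · cases h : w i with
    | none => exact .inr ⟨(), fun x => by simp [h]⟩
    | some b => exact .inl ⟨b, fun x => by simp [h]⟩
  · obtain ⟨i, hi⟩ := hw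
    exact ⟨i, fun x => by simp [hi]⟩

open Combinatorics

/-- Given a colouring `C`, there is a rigid subspace on which the colour does not depend on the
second block of coordinates if the first block contains `none` at some place in `s`. -/
lemma exists_rigid_independent {α : Type} [Finite α] {H : Type} [Finite H] (s : Finset H)
    (ι' κ : Type) [Finite ι'] [Finite κ] : ∃ (ι : Type) (_ : Finite ι),
      ∀ C : (H ⊕ ι → Option α) → κ, ∃ e : (H ⊕ ι' → Option α) → (H ⊕ ι → Option α),
        IsRigid e ∧ (∀ x j, e x (.inl j) = x (.inl j)) ∧
          ∀ v, (∃ i ∈ s, v i = none) →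
            ∀ u u', C (e (Sum.elim v u)) = C (e (Sum.elim v u')) := by
  classical
  induction s using Finset.induction_on generalizing ι' with
  | empty =>
    exact ⟨ι', inferInstance, fun C => ⟨_, isRigid_id, fun _ _ => rfl, by simp⟩⟩
  | insert i s _ ih =>
    obtain ⟨ι₁, hι₁, h₁⟩ :=
      Subspace.exists_mono_in_high_dimension (Option α) ((H → Option α) → κ) ι'
    obtain ⟨ι, hι, h⟩ := ih ι₁
    refine ⟨ι, hι, fun C => ?_⟩
    obtain ⟨e₁, he₁, hv₁, hC₁⟩ := h C
    obtain ⟨l, c, hl⟩ := h₁ fun u v => C (e₁ (Sum.elim v u))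
    let f : (H ⊕ ι' → Option α) → (H ⊕ ι₁ → Option α) := fun x =>
      Sum.elim (fun j => x (.inl j)) fun k =>
        (l.idxFun k).elim (fun b => b.elim (x (.inl i)) some) fun j => x (.inr j)
    have hf : IsRigid f := by
      refine ⟨?_, ?_⟩
      · rintro (j | k)
        · exact .inr ⟨.inl j, fun x => rfl⟩
        · rcases hk : l.idxFun k with (_ | a) | j
          · exact .inr ⟨.inl i, fun x => by simp [f, hk]⟩
          · exact .inl ⟨a, fun x => by simp [f, hk]⟩
          · exact .inr ⟨.inr j, fun x => by simp [f, hk]⟩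
      · rintro (j | j)
        · exact ⟨.inl j, fun x => rfl⟩
        · obtain ⟨k, hk⟩ := l.proper j
          exact ⟨.inr k, fun x => by simp [f, hk]⟩
    refine ⟨fun x => e₁ (f x), he₁.comp hf, fun x j => hv₁ _ _, ?_⟩
    rintro v ⟨j, hj, hvj⟩ u u'
    rcases Finset.mem_insert.1 hj with rfl | hj
    · have key : ∀ u, f (Sum.elim v u) = Sum.elim v (l u) := by
        intro u
        funext k
        rcases k with k | k
        · rfl
        · rcases hk : l.idxFun k with (_ | a) | j <;> simp [f, hk, hvj, Subspace.apply_def]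
      simp only [key]
      exact (congrFun (hl u) v).trans (congrFun (hl u') v).symm
    · exact hC₁ v ⟨j, hj, hvj⟩ _ _

/-- For every finite colouring, there is a rigid subspace of prescribed dimension such that the
colour of a word containing `none` is determined by the position of one of the letters `none`. -/
lemma exists_rigid_colour (α : Type) [Finite α] (η : Type) [Finite η] : ∀ (κ : Type) [Finite κ],
    ∃ (ι : Type) (_ : Finite ι), ∀ C : (ι → Option α) → κ,
      ∃ e : (η → Option α) → (ι → Option α), IsRigid e ∧ ∃ col : η → κ,
        ∀ w, (∃ i, w i = none) → ∃ i, w i = none ∧ C (e w) = col i := by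
  induction η using induction_sum_unit with
  | @of_equiv η η' σ ih =>
    intro κ _
    obtain ⟨ι, hι, h⟩ := ih κ
    refine ⟨ι, hι, fun C => ?_⟩
    obtain ⟨e, he, col, hcol⟩ := h C
    refine ⟨_, he.comp (isRigid_reindex σ), fun i => col (σ.symm i), fun w ⟨i, hi⟩ => ?_⟩
    obtain ⟨j, hj, hw⟩ := hcol (fun j => w (σ j)) ⟨σ.symm i, by simpa using hi⟩
    exact ⟨σ j, hj, by simpa using hw⟩
  | empty =>
    intro κ _
    exact ⟨PEmpty, inferInstance, fun C => ⟨_, isRigid_id, PEmpty.elim, fun w ⟨i, _⟩ => i.elim⟩⟩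
  | @sum_unit η _ ih =>
    intro κ _
    obtain ⟨H, _, hH⟩ := Line.exists_mono_in_high_dimension α (η → κ)
    obtain ⟨ι', _, h'⟩ := ih ((H → α) → κ)
    obtain ⟨ι, hι, h⟩ := exists_rigid_independent (α := α) (Finset.univ : Finset H) ι' κ
    refine ⟨H ⊕ ι, inferInstance, fun C => ?_⟩
    obtain ⟨e, he, -, hC⟩ := h C
    obtain ⟨e₂, he₂, col, hcol⟩ := h' fun u v => C (e (Sum.elim (fun j => some (v j)) u))
    obtain ⟨l, c, hl⟩ := hH fun v i => col i v
    refine ⟨_, he.comp (((isRigid_subst l.proper).prod he₂).comp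
      (isRigid_reindex (Equiv.sumComm Unit η))), Sum.elim c fun _ =>
        C (e (Sum.elim l.idxFun fun _ => none)), fun w hw => ?_⟩
    simp only [Equiv.sumComm_apply, Sum.swap_inl, Sum.swap_inr]
    cases hb : w (.inr ()) with
    | none =>
      refine ⟨.inr (), hb, ?_⟩
      have : (fun j => (l.idxFun j).elim none some) = l.idxFun := by
        funext j; cases l.idxFun j <;> rfl
      rw [this]
      exact hC _ (l.proper.imp fun j hj => ⟨Finset.mem_univ _, hj⟩) _ _
    | some a =>
      obtain ⟨i, hi, hw'⟩ := hcol (fun j => w (.inl j)) (by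
        obtain ⟨i | i, hi⟩ := hw
        · exact ⟨i, hi⟩
        · simp [hb] at hi)
      refine ⟨.inl i, hi, ?_⟩
      have : (fun j => (l.idxFun j).elim (some a) some) = fun j => some (l a j) := by
        funext j; cases h : l.idxFun j <;> simp [h]
      rw [this]
      exact (congrFun hw' (l a)).trans (congrFun (hl a) i)

/-- For every finite colouring, there is a rigid subspace of prescribed dimension whose words
containing `none` have the same colour: this is the Graham-Rothschild theorem for lines. -/
lemma exists_rigid_mono (α : Type) [Finite α] [Nonempty α] (ζ κ : Type) [Finite ζ] [Finite κ] :
    ∃ (ι : Type) (_ : Finite ι), ∀ C : (ι → Option α) → κ,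
      ∃ e : (ζ → Option α) → (ι → Option α), IsRigid e ∧
        ∀ w w', (∃ i, w i = none) → (∃ i, w' i = none) → C (e w) = C (e w') := by
  classical
  let _ := Fintype.ofFinite κ
  let _ := Fintype.ofFinite ζ
  let η := Fin (Fintype.card κ * Fintype.card ζ + 1)
  obtain ⟨ι, hι, h⟩ := exists_rigid_colour α η κ
  refine ⟨ι, hι, fun C => ?_⟩
  obtain ⟨e, he, col, hcol⟩ := h C
  obtain ⟨c, hc⟩ := Fintype.exists_lt_card_fiber_of_mul_lt_card (n := Fintype.card ζ) col
    (by simp [η])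
  obtain ⟨φ⟩ : Nonempty (ζ ↪ {i // col i = c}) := by
    apply Function.Embedding.nonempty_of_card_le
    rw [Fintype.card_subtype]
    exact hc.le
  obtain ⟨a₀⟩ := ‹Nonempty α›
  let f : (ζ → Option α) → (η → Option α) := fun x i =>
    if h : ∃ j, (φ j : η) = i then x h.choose else some a₀
  have hinl : ∀ x j, f x (φ j) = x j := by
    intro x j
    have h : ∃ k, (φ k : η) = φ j := ⟨j, rfl⟩
    have h2 : h.choose = j := φ.injective (Subtype.ext h.choose_spec)
    simp only [f, dif_pos h, h2]
  have hout : ∀ x i, (¬ ∃ j, (φ j : η) = i) → f x i = some a₀ := fun x i hi => by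
    simp only [f, dif_neg hi]
  have hf : IsRigid f := by
    refine ⟨fun i => ?_, fun j => ⟨φ j, fun x => hinl x j⟩⟩
    by_cases hi : ∃ j, (φ j : η) = i
    · obtain ⟨j, rfl⟩ := hi
      exact .inr ⟨j, fun x => hinl x j⟩
    · exact .inl ⟨a₀, fun x => hout x i hi⟩
  have key : ∀ w, (∃ i, w i = none) → C (e (f w)) = c := by
    rintro w ⟨j, hj⟩
    obtain ⟨i, hi, hw⟩ := hcol (f w) ⟨φ j, (hinl w j).trans hj⟩
    by_cases hi' : ∃ j, (φ j : η) = i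
    · obtain ⟨j, rfl⟩ := hi'
      rw [hw, (φ j).2]
    · rw [hout w i hi'] at hi
      cases hi
  exact ⟨_, he.comp hf, fun w w' hw hw' => (key w hw).trans (key w' hw').symm⟩

end graham_rothschild

/-! ### The density increment -/

lemma sub_mul_le_of_le_avg {X : Type*} [Finite X] {f : X → ℝ} {b m : ℝ} (hf : ∀ x, f x ≤ b)
    (hm : m ≤ avg f) (x : X) : b - Nat.card X * (b - m) ≤ f x := by
  have : Nonempty X := ⟨x⟩
  let _ := Fintype.ofFinite X
  have hX : (0 : ℝ) < Nat.card X := by exact_mod_cast Nat.card_pos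
  have h1 : b - avg f = (∑ y, (b - f y)) / Nat.card X := by
    rw [← avg_const (X := X) b, ← avg_sub]
    simp [avg]
  have h2 : b - f x ≤ ∑ y, (b - f y) :=
    Finset.single_le_sum (f := fun y => b - f y) (fun y _ => sub_nonneg.2 (hf y))
      (Finset.mem_univ x)
  rw [eq_div_iff hX.ne'] at h1
  nlinarith

section increment

variable {α : Type} [Finite α]

/-- Almost all words of large length contain `none`. -/
lemma exists_avg_forall_ne_none_le (α : Type) [Finite α] [Nonempty α] {ε : ℝ} (hε : 0 < ε) :
    ∃ (ι : Type) (_ : Finite ι),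
      avg (fun z : ι → Option α => ind (∀ i, z i ≠ none)) ≤ ε := by
  have hα : (0 : ℝ) < Nat.card α := by exact_mod_cast Nat.card_pos
  obtain ⟨L, hL⟩ := exists_pow_lt_of_lt_one hε
    (show (Nat.card α / (Nat.card α + 1) : ℝ) < 1 by
      rw [div_lt_one (by linarith)]
      linarith)
  suffices h : ∀ L : ℕ, ∃ (ι : Type) (_ : Finite ι),
      avg (fun z : ι → Option α => ind (∀ i, z i ≠ none)) ≤
        (Nat.card α / (Nat.card α + 1) : ℝ) ^ L by
    obtain ⟨ι, hι, h⟩ := h L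
    exact ⟨ι, hι, h.trans hL.le⟩
  intro L
  induction L with
  | zero => exact ⟨PEmpty, inferInstance, by rw [pow_zero]; exact avg_le fun _ => ind_le_one _⟩
  | succ L ih =>
    obtain ⟨ι, _, h⟩ := ih
    refine ⟨Unit ⊕ ι, inferInstance, ?_⟩
    rw [avg_sumElim, avg_unit_option]
    have h0 : (avg fun z : ι → Option α =>
        ind (∀ i, (Sum.elim (fun _ : Unit => none) z : Unit ⊕ ι → Option α) i ≠ none)) = 0 := by
      rw [avg_congr (g := fun _ => 0) fun z => ind_of_not fun h => h (.inl ()) rfl, avg_const]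
    have h1 : ∀ a : Unit → α, (avg fun z : ι → Option α =>
        ind (∀ i, (Sum.elim (fun u : Unit => some (a u)) z : Unit ⊕ ι → Option α) i ≠ none)) =
          avg (fun z : ι → Option α => ind (∀ i, z i ≠ none)) := fun a =>
      avg_congr fun z => congrArg ind (by simp)
    rw [h0, avg_congr h1, avg_const, add_zero, pow_succ, mul_comm (_ ^ L), div_mul_eq_mul_div]
    gcongr

/-- A set without lines whose sections are all dense has increased density on a subspace. -/
lemma exists_density_increment [Nonempty α] (hα : DHJ α) {δ : ℝ} (hδ : 0 < δ) (hδ2 : δ ≤ 2) :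
    ∃ c : ℝ, 0 < c ∧ ∀ (ξ : Type) [Finite ξ], ∃ (G : Type) (_ : Finite G),
      ∀ (Y : Type) [Finite Y] (A : Set (G ⊕ Y → Option α)), ¬ HasLine A →
        (∀ t, δ - c ≤ avg fun x => ind (Sum.elim t x ∈ A)) →
          ∃ e : (ξ → Option α) → (G ⊕ Y → Option α), IsSubspace e ∧
            δ + c ≤ avg fun u => ind (e u ∈ A) := by
  classical
  obtain ⟨a₀⟩ := ‹Nonempty α›
  obtain ⟨M, _, hM⟩ := hα (δ / 4) (by linarith)
  let V := {e : (Unit → α) → (M → α) // IsSubspace e}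
  set θ : ℝ := δ / 4 / (Nat.card V + 1) with hθ
  have hθ0 : 0 < θ := by positivity
  have hθ1 : θ ≤ 1 / 2 := by
    have : θ ≤ δ / 4 :=
      div_le_self (by linarith) (by linarith [Nat.cast_nonneg (α := ℝ) (Nat.card V)])
    linarith
  set c : ℝ := δ * θ / 8 with hc
  have hc0 : 0 < c := by positivity
  have hc1 : c ≤ 1 / 8 := by nlinarith
  have hcδ : c ≤ δ / 2 := by nlinarith
  refine ⟨c, hc0, fun ξ _ => ?_⟩
  let _ := Fintype.ofFinite α
  obtain ⟨ζ, _, hζ⟩ := exists_subspace_of_le_avg_compl hα ξ Finset.univ c hc0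
  obtain ⟨L, _, hL⟩ := exists_avg_forall_ne_none_le α hc0
  obtain ⟨G, hG, h⟩ := exists_rigid_mono α (M ⊕ (ζ ⊕ L)) Prop
  refine ⟨G, hG, fun Y _ A hA hsec => ?_⟩
  let sub : α → (G → Option α) → (G → Option α) := fun a t j => (t j).elim (some a) some
  let P : (G → Option α) → (Y → Option α) → Prop := fun t x => ∀ a, Sum.elim (sub a t) x ∈ A
  obtain ⟨e, he, hC⟩ := h fun t => θ ≤ avg fun x => ind (P t x)
  have hsub : ∀ a w, sub a (e w) = e fun j => (w j).elim (some a) some := fun a w =>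
    funext fun i => (he.map_subst (some a) w i).symm
  have hgood : ∃ w, (∃ i, w i = none) ∧ θ ≤ avg fun x => ind (P (e w) x) := by
    obtain ⟨⟨l, hl⟩, hle⟩ := exists_dense_fibres (η := δ / 2) (by linarith)
      (fun v : V => Set.range v.1)
      (fun (w : M → α) (x : Y → Option α) =>
        Sum.elim (e (Sum.elim (fun j => some (w j)) fun _ => some a₀)) x ∈ A)
      (fun x hx => by
        obtain ⟨l, hl, hlA⟩ :=
          hM {w | Sum.elim (e (Sum.elim (fun j => some (w j)) fun _ => some a₀)) x ∈ A} (by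
            simp only [Set.mem_ofPred_eq]; linarith)
        exact ⟨⟨l, hl⟩, by rintro _ ⟨w, rfl⟩; exact hlA w⟩)
      (le_avg fun w => by
        have := hsec (e (Sum.elim (fun j => some (w j)) fun _ => some a₀))
        linarith)
    obtain ⟨w, ⟨i, hi⟩, hw⟩ := hl.exists_word
    refine ⟨Sum.elim w fun _ => some a₀, ⟨.inl i, hi⟩, ?_⟩
    have hθ' : θ = δ / 2 / 2 / (Nat.card V + 1) := by rw [hθ]; ring
    rw [hθ']
    refine hle.trans (avg_mono fun x => ind_mono fun hx a => ?_)
    rw [hsub]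
    convert hx (l fun _ => a) ⟨_, rfl⟩ using 3
    funext j
    rcases j with j | j
    · simp only [Sum.elim_inl, hw]
      cases w j <;> rfl
    · rfl
  have hP : ∀ w, (∃ i, w i = none) → θ ≤ avg fun x => ind (P (e w) x) := by
    obtain ⟨w₀, hw₀, hle⟩ := hgood
    intro w hw
    exact (hC w₀ w hw₀ hw).mp hle
  have hline : ∀ w x, (∃ i, w i = none) → P (e w) x → Sum.elim (e w) x ∉ A := by
    rintro w x ⟨j, hj⟩ hwP hwA
    obtain ⟨i, hi⟩ := he.2 j
    refine hA ⟨_, (isRigid_subst ⟨i, (hi w).trans hj⟩).isSubspace.elim_right x, fun u => ?_⟩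
    cases hu : u () with
    | none =>
      convert hwA using 2
      funext k
      cases e w k <;> rfl
    | some a => exact hwP a
  let w : (ζ → Option α) → (L → Option α) → (M ⊕ (ζ ⊕ L) → Option α) := fun y z =>
    Sum.elim (fun _ => some a₀) (Sum.elim y z)
  let f : (L → Option α) → (Y → Option α) → (ζ → Option α) → ℝ := fun z x y =>
    ind (Sum.elim (e (w y z)) x ∈ A) - (δ + c)
  let D : (L → Option α) → (Y → Option α) → α → Set (ζ → Option α) := fun z x a =>
    {y | Sum.elim (sub a (e (w y z))) x ∈ A}
  have hf : ∀ z x y, f z x y ≤ 1 := fun z x y => by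
    have := ind_le_one (Sum.elim (e (w y z)) x ∈ A)
    simp only [f]; linarith
  have hD : ∀ z x a, IsInsensitive a (D z x a) := by
    intro z x a y y' hyy' hy
    have : sub a (e (w y z)) = sub a (e (w y' z)) := by
      rw [hsub, hsub]
      congr 1
      funext j
      rcases j with j | j | j
      · rfl
      · have h3 := hyy' j
        simp only [w, Sum.elim_inr, Sum.elim_inl]
        cases h1 : y j <;> cases h2 : y' j <;> simp_all
      · rfl
    simpa only [D, Set.mem_ofPred_eq, this] using hy
  have havg : ∀ z y, 6 * c - 4 * ind (∀ i, z i ≠ none) ≤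
      avg fun x => ind (¬ ∀ a ∈ Finset.univ, y ∈ D z x a) * f z x y := by
    intro z y
    by_cases hz : ∀ i, z i ≠ none
    · rw [ind_of hz]
      refine le_avg fun x => ?_
      have h1 := ind_nonneg (Sum.elim (e (w y z)) x ∈ A)
      have h2 := ind_nonneg (¬ ∀ a ∈ Finset.univ, y ∈ D z x a)
      have h3 := ind_le_one (¬ ∀ a ∈ Finset.univ, y ∈ D z x a)
      simp only [f]
      nlinarith
    · rw [ind_of_not hz]
      push Not at hz
      obtain ⟨i, hi⟩ := hz
      have hw : ∃ i, w y z i = none := ⟨.inr (.inr i), hi⟩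
      have hpt : ∀ x, ind (Sum.elim (e (w y z)) x ∈ A) - (δ + c) + (δ + c) * ind (P (e (w y z)) x) ≤
          ind (¬ ∀ a ∈ Finset.univ, y ∈ D z x a) * f z x y := by
        intro x
        by_cases hx : P (e (w y z)) x
        · rw [ind_of hx, ind_of_not (hline _ x hw hx), ind_of_not
            (p := ¬ ∀ a ∈ Finset.univ, y ∈ D z x a) (not_not.2 fun a _ => hx a)]
          linarith
        · rw [ind_of_not hx, ind_of (fun h => hx fun a => h a (Finset.mem_univ a))]
          simp only [f]
          linarith
      refine le_trans ?_ (avg_mono hpt)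
      rw [avg_add, avg_sub, avg_const_mul, avg_const]
      have h1 := hsec (e (w y z))
      have h2 := hP _ hw
      nlinarith
  have htot : c ≤ avg fun z => avg fun x => avg fun y =>
      ind (¬ ∀ a ∈ Finset.univ, y ∈ D z x a) * f z x y := by
    have h1 : ∀ z, 6 * c - 4 * ind (∀ i, z i ≠ none) ≤ avg fun x => avg fun y =>
        ind (¬ ∀ a ∈ Finset.univ, y ∈ D z x a) * f z x y := fun z => by
      rw [avg_comm]
      exact le_avg fun y => havg z y
    refine le_trans ?_ (avg_mono h1)
    rw [avg_sub, avg_const, avg_const_mul]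
    linarith
  obtain ⟨z, hz⟩ := exists_le_of_le_avg htot
  obtain ⟨x, hx⟩ := exists_le_of_le_avg hz
  obtain ⟨v, hv, hle⟩ := hζ (f z x) (D z x) (hf z x) (hD z x) hx
  refine ⟨_, ((he.isSubspace.comp ((hv.elim_right z).elim_left fun _ => some a₀)).elim_right x), ?_⟩
  simp only [f, avg_sub, avg_const] at hle
  linarith

lemma DHJ.option [Nonempty α] (hα : DHJ α) : DHJ (Option α) := by
  by_contra hcon
  unfold DHJ at hcon
  push Not at hcon
  obtain ⟨δ₀, hδ₀, hcon⟩ := hcon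
  let S : Set ℝ := {δ | ∃ (ι : Type) (_ : Finite ι), ∀ A : Set (ι → Option α),
    δ ≤ avg (fun x => ind (x ∈ A)) → HasLine A}
  have hup : ∀ δ ∈ S, ∀ δ', δ ≤ δ' → δ' ∈ S := by
    rintro δ ⟨ι, hι, h⟩ δ' hδ'
    exact ⟨ι, hι, fun A hA => h A (hδ'.trans hA)⟩
  have h2 : (2 : ℝ) ∈ S := ⟨PEmpty, inferInstance, fun A hA => by
    have := avg_le (f := fun x => ind (x ∈ A)) (c := 1) fun x => ind_le_one _
    linarith⟩
  have hlb : ∀ δ ∈ S, δ₀ ≤ δ := by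
    intro δ hδ
    by_contra! hlt
    obtain ⟨ι, hι, h⟩ := hup δ hδ δ₀ hlt.le
    obtain ⟨A, hA, hA'⟩ := hcon ι hι
    exact hA' (h A hA)
  have hbdd : BddBelow S := ⟨δ₀, hlb⟩
  set δ := sInf S with hδ
  have hδ0 : 0 < δ := hδ₀.trans_le (le_csInf ⟨2, h2⟩ hlb)
  have habove : ∀ δ', δ < δ' → δ' ∈ S := fun δ' h => by
    obtain ⟨s, hs, hlt⟩ := exists_lt_of_csInf_lt ⟨2, h2⟩ h
    exact hup s hs _ hlt.le
  obtain ⟨c, hc0, hinc⟩ := exists_density_increment hα hδ0 (csInf_le hbdd h2)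
  obtain ⟨ξ, _, hξ⟩ := habove (δ + c) (by linarith)
  obtain ⟨G, _, hG⟩ := hinc ξ
  set K : ℝ := (Nat.card (G → Option α) : ℝ)
  have hK : 0 < K := by simp only [K]; exact_mod_cast Nat.card_pos
  set γ : ℝ := c / (2 * K) with hγ
  have hγ0 : 0 < γ := by positivity
  have hγK : 2 * K * γ = c := by rw [hγ]; field_simp
  obtain ⟨Y, _, hY⟩ := habove (δ + γ) (by linarith)
  have hnot : δ - γ ∉ S := fun h => by
    have := csInf_le hbdd h
    linarith
  simp only [S, Set.mem_ofPred_eq] at hnot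
  push Not at hnot
  obtain ⟨A, hA, hAline⟩ := hnot (G ⊕ Y) inferInstance
  rw [avg_sumElim] at hA
  have hsec : ∀ t, δ - c ≤ avg fun x => ind (Sum.elim t x ∈ A) := by
    intro t
    refine le_trans ?_ (sub_mul_le_of_le_avg (b := δ + γ) (fun t => ?_) hA t)
    · change δ - c ≤ δ + γ - K * (δ + γ - (δ - γ))
      linarith
    · by_contra! hlt
      exact hAline (HasLine.of_preimage (isSubspace_id.elim_left t) (hY _ hlt.le))
  obtain ⟨e, he, hle⟩ := hG Y A hAline hsec
  exact hAline (HasLine.of_preimage he (hξ _ hle))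

end increment

/-- The **density Hales-Jewett theorem**. -/
theorem dhj (α : Type) [Finite α] : DHJ α := by
  refine Finite.induction_empty_option (P := fun α => ∀ [Finite α], DHJ α) ?_ ?_ ?_ α
  · intro α β σ h _ δ hδ
    have _ : Finite α := Finite.of_equiv β σ.symm
    obtain ⟨ι, hι, h⟩ := h δ hδ
    refine ⟨ι, hι, fun A hA => ?_⟩
    obtain ⟨e, he, heA⟩ := h {x | (fun i => σ (x i)) ∈ A}
      (hA.trans_eq (avg_equiv (Equiv.arrowCongr (Equiv.refl ι) σ) fun x => ind (x ∈ A)).symm)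
    refine ⟨fun x i => σ (e (fun u => σ.symm (x u)) i), ⟨fun i => ?_, fun j => ?_⟩,
      fun x => heA _⟩
    · exact (he.1 i).imp (fun ⟨b, hb⟩ => ⟨σ b, fun x => by simp only [hb]⟩)
        fun ⟨j, hj⟩ => ⟨j, fun x => by simp only [hj, σ.apply_symm_apply]⟩
    · exact (he.2 j).imp fun i hi x => by simp only [hi, σ.apply_symm_apply]
  · intro _ δ _
    exact ⟨Unit, inferInstance, fun A _ => ⟨_, isSubspace_id, fun x => (x ()).elim⟩⟩
  · intro α _ h _
    rcases isEmpty_or_nonempty α with hα | hα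
    · intro δ hδ
      refine ⟨Unit, inferInstance, fun A hA => ⟨_, isSubspace_id, fun x => ?_⟩⟩
      obtain ⟨y, hy⟩ := exists_le_of_le_avg hA
      by_contra hx
      rw [Subsingleton.elim y x, ind_of_not hx] at hy
      linarith
    · exact DHJ.option h

/-! ### Constellations -/

lemma exists_shift {d : ℕ} {W : Type*} [Finite W] [Nonempty W] (φ : W → Fin d → ℤ) {C : ℕ}
    (hC : ∀ w i, |φ w i| ≤ C) {N : ℕ} {δ : ℝ} (hN : 0 < N) (hδ : 0 < δ)
    (hNC : ((N : ℝ) + 2 * C) ^ d ≤ 2 * (N : ℝ) ^ d) {A : Finset (Fin d → ℤ)}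
    (hA : A ⊆ Fintype.piFinset fun _ : Fin d => Finset.Icc (1 : ℤ) (N : ℤ))
    (hcard : δ * (N : ℝ) ^ d ≤ (A.card : ℝ)) :
    ∃ a : Fin d → ℤ, δ / 2 ≤ avg fun w => ind (a + φ w ∈ A) := by
  classical
  set B := Fintype.piFinset fun _ : Fin d => Finset.Icc (1 - C : ℤ) (N + C : ℤ) with hB
  have hBcard : (B.card : ℝ) = ((N : ℝ) + 2 * C) ^ d := by
    rw [hB, Fintype.card_piFinset_const, Int.card_Icc,
      show ((N : ℤ) + C + 1 - (1 - C)).toNat = N + 2 * C by omega]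
    push_cast
    rfl
  have hB0 : (0 : ℝ) < B.card := by rw [hBcard]; positivity
  have : Nonempty B := (Finset.card_pos.1 (by exact_mod_cast hB0)).to_subtype
  obtain ⟨a, ha⟩ := exists_le_of_le_avg
    (f := fun a : B => avg fun w => ind (a.1 + φ w ∈ A)) (c := δ / 2) (by
    rw [avg_comm]
    refine le_avg fun w => ?_
    have hsub : A.image (fun b => b - φ w) ⊆ B := by
      intro b hb
      obtain ⟨b, hbA, rfl⟩ := Finset.mem_image.1 hb
      rw [hB, Fintype.mem_piFinset]
      intro i
      have h1 := Finset.mem_Icc.1 (Fintype.mem_piFinset.1 (hA hbA) i)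
      have h2 := abs_le.1 (hC w i)
      rw [Finset.mem_Icc, Pi.sub_apply]
      constructor <;> linarith
    have hsum : (A.card : ℝ) ≤ ∑ a : B, ind (a.1 + φ w ∈ A) := by
      rw [Finset.sum_coe_sort B fun a => ind (a + φ w ∈ A)]
      refine le_trans (le_of_eq ?_) (Finset.sum_le_sum_of_subset_of_nonneg hsub fun _ _ _ =>
        ind_nonneg _)
      rw [Finset.sum_image fun _ _ _ _ h => sub_left_injective h]
      rw [Finset.sum_congr rfl (g := fun _ => (1 : ℝ)) fun b hb =>
        ind_of (by rwa [sub_add_cancel])]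
      simp
    rw [avg, Subsingleton.elim (Fintype.ofFinite B) (Finset.fintypeCoeSort B),
      Nat.card_eq_fintype_card, Fintype.card_coe, le_div_iff₀ hB0, hBcard]
    have := mul_le_mul_of_nonneg_left hNC hδ.le
    linarith)
  exact ⟨a.1, ha⟩

/-- Sums of vectors along a combinatorial line form a constellation. -/
lemma sum_elim_eq_add_smul {κ ι E : Type*} [Fintype ι] [AddCommGroup E] (v : κ → E)
    (w : ι → Option κ) [DecidablePred fun i => w i = none] (j : κ) :
    ∑ i, v ((w i).elim j id) = ∑ i, (w i).elim 0 v + ({i | w i = none} : Finset ι).card • v j := by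
  rw [← Finset.sum_const, Finset.sum_filter, ← Finset.sum_add_distrib]
  refine Finset.sum_congr rfl fun i _ => ?_
  obtain h | ⟨b, h⟩ := (w i).eq_none_or_eq_some <;> simp [h]

lemma exists_forall_add_pow_le (C d : ℕ) : ∃ N₀ : ℕ, 0 < N₀ ∧ ∀ N : ℕ, N₀ ≤ N →
    ((N : ℝ) + 2 * C) ^ d ≤ 2 * (N : ℝ) ^ d := by
  have h := ((tendsto_const_div_atTop_nhds_zero_nat (2 * C : ℝ)).const_add 1).pow d
  rw [add_zero, one_pow] at h
  obtain ⟨N₀, hN₀⟩ := Filter.eventually_atTop.1 (h.eventually_le_const one_lt_two)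
  refine ⟨N₀ + 1, N₀.succ_pos, fun N hN => ?_⟩
  have hN' : (0 : ℝ) < N := by exact_mod_cast (show 0 < N by omega)
  have h1 : (N : ℝ) + 2 * C = (1 + 2 * C / N) * N := by field_simp
  rw [h1, mul_pow]
  exact mul_le_mul_of_nonneg_right (hN₀ N (by omega)) (by positivity)

end DensityHalesJewett

open DensityHalesJewett in
/-- **Multidimensional Szemerédi theorem** (Furstenberg–Katznelson). For every `d ≥ 1`,
every finite list `v 0, …, v (k-1)` of elements of `ℤ^d` and every `δ > 0` there is `N₀`
such that for all `N ≥ N₀`, every subset `A` of `[N]^d` with `|A| ≥ δ N^d` contains a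
constellation `a + r • v 0, …, a + r • v (k-1)` with `r` a positive integer. -/
theorem multidim_szemeredi (d : ℕ) (hd : 1 ≤ d) (k : ℕ) (v : Fin k → Fin d → ℤ)
    (δ : ℝ) (hδ : 0 < δ) :
    ∃ N₀ : ℕ, ∀ N : ℕ, N₀ ≤ N →
      ∀ A ⊆ Fintype.piFinset (fun _ : Fin d => Finset.Icc (1 : ℤ) (N : ℤ)),
        δ * (N : ℝ) ^ d ≤ (A.card : ℝ) →
          ∃ a : Fin d → ℤ, ∃ r : ℤ, 0 < r ∧ ∀ j, a + r • v j ∈ A := by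
  classical
  rcases isEmpty_or_nonempty (Fin k) with hk | hk
  · exact ⟨0, fun N _ A _ _ => ⟨0, 1, one_pos, fun j => hk.elim j⟩⟩
  obtain ⟨ι, _, hι⟩ := dhj (Fin k) (δ / 2) (by linarith)
  let _ := Fintype.ofFinite ι
  let φ : (ι → Fin k) → Fin d → ℤ := fun w => ∑ i, v (w i)
  obtain ⟨C, hC⟩ : ∃ C : ℕ, ∀ w i, |φ w i| ≤ C := by
    obtain ⟨C, hC⟩ := (Set.finite_range fun p : (ι → Fin k) × Fin d => (φ p.1 p.2).natAbs).bddAbove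
    refine ⟨C, fun w i => ?_⟩
    have := hC ⟨(w, i), rfl⟩
    rw [Int.abs_eq_natAbs]
    exact_mod_cast this
  obtain ⟨N₀, hN₀, hN⟩ := exists_forall_add_pow_le C d
  refine ⟨N₀, fun N hNN A hA hcard => ?_⟩
  obtain ⟨a, ha⟩ := exists_shift φ hC (hN₀.trans_le hNN) hδ (hN N hNN) hA hcard
  obtain ⟨e, he, heA⟩ := hι {w | a + φ w ∈ A} ha
  obtain ⟨w, ⟨i, hi⟩, hw⟩ := he.exists_word
  refine ⟨a + ∑ i, (w i).elim 0 v, (({i | w i = none} : Finset ι).card : ℤ), ?_, fun j => ?_⟩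
  · exact_mod_cast Finset.card_pos.2 ⟨i, by simpa using hi⟩
  · have h : a + ∑ i, v (e (fun _ => j) i) ∈ A := heA fun _ => j
    simp only [hw] at h
    rwa [sum_elim_eq_add_smul, ← add_assoc, ← natCast_zsmul] at h
end

section
/- Let d ≥ 1 be a fixed natural number, let N_n be a sequence of natural numbers tending to infinity, and for each n let A_n ⊆ [N_n]^d satisfy limsup_{n→∞} E_{a ∈ [N_n]^d} 1_{A_n}(a) ≥ δ for some δ > 0. Then there exists a ℤ^d-system (X, 𝓑, μ, (T_h)_{h ∈ ℤ^d}) and a set E ∈ 𝓑 with μ(E) ≥ δ, such that whenever h_1, …, h_k ∈ ℤ^d satisfy μ(T_{h_1} E ∩ … ∩ T_{h_k} E) > 0, then for a sequence of n tending to infinity there exists a ∈ [N_n]^d with a + h_1, …, a + h_k ∈ A_n. -/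
open Filter MeasureTheory

noncomputable section

/-- The interval `[N] = {n : ℤ | 1 ≤ n ≤ N}` as a finset of integers. -/
def intBox (N : ℕ) : Finset ℤ := Finset.Icc 1 (N : ℤ)

/-- The box `[N]^d ⊆ ℤ^d`. -/
def cube (d N : ℕ) : Finset (Fin d → ℤ) := Fintype.piFinset fun _ => intBox N

/-- The average `E_{a ∈ S} f(a) = (1/|S|) ∑_{a ∈ S} f a`. -/
def favg {α : Type*} (S : Finset α) (f : α → ℝ) : ℝ := (∑ a ∈ S, f a) / S.card

open Topology

/-- The shift of `ℤ^d` on `{0,1}^(ℤ^d)`, translating configurations by `h`. -/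
def shift {d : ℕ} (h : Fin d → ℤ) (x : (Fin d → ℤ) → Bool) : (Fin d → ℤ) → Bool :=
  fun m => x (m - h)

lemma shift_add {d : ℕ} (h h' : Fin d → ℤ) : shift (h + h') = shift h ∘ shift h' := by
  ext x m
  simp [shift, sub_sub]

lemma shift_bijective {d : ℕ} (h : Fin d → ℤ) : Function.Bijective (shift h) := by
  refine Function.bijective_iff_has_inverse.2 ⟨shift (-h), fun x => ?_, fun x => ?_⟩ <;>
  · ext m
    simp [shift]

lemma continuous_shift {d : ℕ} (h : Fin d → ℤ) : Continuous (shift h) := by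
  unfold shift
  fun_prop

lemma image_shift {d : ℕ} (h : Fin d → ℤ) :
    shift h '' {x | x 0 = true} = {x | x h = true} := by
  ext y
  constructor
  · rintro ⟨x, hx, rfl⟩
    simpa [shift] using hx
  · intro hy
    obtain ⟨x, rfl⟩ := (shift_bijective h).2 y
    exact ⟨x, by simpa [shift] using hy, rfl⟩

/-- The indicator configuration of the finite set `A` seen from the point `a`. -/
def viewFrom {d : ℕ} (A : Finset (Fin d → ℤ)) (a : Fin d → ℤ) : (Fin d → ℤ) → Bool :=
  fun m => decide (a + m ∈ A)

lemma shift_viewFrom {d : ℕ} (A : Finset (Fin d → ℤ)) (a h : Fin d → ℤ) :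
    shift h (viewFrom A a) = viewFrom A (a - h) := by
  ext m
  simp only [shift, viewFrom]
  congr 2
  abel_nf

/-- The uniform distribution on a nonempty finset, pushed forward by `f`. -/
lemma exists_probabilityMeasure_eq_favg {α X : Type*} [MeasurableSpace X] [Nonempty X]
    (S : Finset α) (f : α → X) :
    ∃ P : ProbabilityMeasure X, S.Nonempty → ∀ s, MeasurableSet s →
      (P : Measure X).real s = favg S fun a => s.indicator 1 (f a) := by
  by_cases hS : S.Nonempty
  · have hc : (S.card : ENNReal) ≠ 0 := by simpa using hS.ne_empty
    let ν : Measure X := (S.card : ENNReal)⁻¹ • ∑ a ∈ S, Measure.dirac (f a)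
    have hν : IsProbabilityMeasure ν := by
      refine ⟨?_⟩
      simp [ν, ENNReal.inv_mul_cancel hc]
    refine ⟨⟨ν, hν⟩, fun _ s hs => ?_⟩
    have h1 : ∀ a ∈ S, (s.indicator 1 (f a) : ENNReal) ≠ ⊤ := by
      intro a _
      by_cases h : f a ∈ s <;> simp [h]
    simp only [Measure.real, ProbabilityMeasure.coe_mk, ν, Measure.smul_apply,
      Measure.finsetSum_apply, Measure.dirac_apply' _ hs, smul_eq_mul, ENNReal.toReal_mul,
      ENNReal.toReal_inv, ENNReal.toReal_natCast, ENNReal.toReal_sum h1, favg]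
    rw [div_eq_inv_mul]
    congr 1
    refine Finset.sum_congr rfl fun a _ => ?_
    by_cases h : f a ∈ s <;> simp [h]
  · exact ⟨⟨Measure.dirac (Classical.arbitrary X), inferInstance⟩, fun h => absurd h hS⟩

lemma card_cube (d N : ℕ) : (cube d N).card = N ^ d := by
  simp [cube, intBox]

lemma favg_cube_sub_le {d : ℕ} (N H : ℕ) (h : Fin d → ℤ) (hH : ∀ i, |h i| ≤ H)
    (hN : 2 * H ≤ N) (hN0 : 0 < N) (p : Set (Fin d → ℤ)) :
    favg (cube d N) (fun a => p.indicator (1 : (Fin d → ℤ) → ℝ) (a - h)) ≤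
      favg (cube d N) (fun a => p.indicator 1 a) + (1 - (1 - 2 * H / (N : ℝ)) ^ d) := by
  classical
  let I : Finset (Fin d → ℤ) := Fintype.piFinset fun _ => Finset.Icc (1 + H : ℤ) (N - H)
  have hI : (I.card : ℝ) = ((N : ℝ) - 2 * H) ^ d := by
    have : ((N : ℤ) - H + 1 - (1 + H)).toNat = N - 2 * H := by omega
    simp only [I, Fintype.card_piFinset, Int.card_Icc, this, Finset.prod_const,
      Finset.card_univ, Fintype.card_fin]
    push_cast [Nat.cast_sub hN]
    ring
  have hIsub : I ⊆ cube d N := by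
    intro a ha
    simp only [I, cube, intBox, Fintype.mem_piFinset, Finset.mem_Icc] at ha ⊢
    intro i
    have := ha i
    omega
  have himg : I.image (fun a => a - h) ⊆ cube d N := by
    intro a ha
    obtain ⟨b, hb, rfl⟩ := Finset.mem_image.1 ha
    simp only [I, cube, intBox, Fintype.mem_piFinset, Finset.mem_Icc, Pi.sub_apply] at hb ⊢
    intro i
    have := hb i
    have := abs_le.1 (hH i)
    omega
  have hnn : ∀ a, 0 ≤ p.indicator (1 : (Fin d → ℤ) → ℝ) a :=
    Set.indicator_nonneg fun _ _ => zero_le_one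
  have hle : ∀ a, p.indicator (1 : (Fin d → ℤ) → ℝ) a ≤ 1 :=
    Set.indicator_le_self' (fun _ _ => zero_le_one)
  have h1 : ∑ a ∈ I, p.indicator (1 : (Fin d → ℤ) → ℝ) (a - h) ≤
      ∑ a ∈ cube d N, p.indicator 1 a := by
    rw [← Finset.sum_image (f := p.indicator (1 : (Fin d → ℤ) → ℝ)) (g := fun a => a - h)
      (sub_left_injective.injOn)]
    exact Finset.sum_le_sum_of_subset_of_nonneg himg fun a _ _ => hnn a
  have h2 : ∑ a ∈ cube d N \ I, p.indicator (1 : (Fin d → ℤ) → ℝ) (a - h) ≤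
      (N : ℝ) ^ d - ((N : ℝ) - 2 * H) ^ d := by
    calc _ ≤ ∑ a ∈ cube d N \ I, (1 : ℝ) := Finset.sum_le_sum fun a _ => hle _
      _ = _ := by
        rw [Finset.sum_const, nsmul_one, Finset.cast_card_sdiff hIsub, card_cube, hI]
        push_cast
        rfl
  have hNpos : (0 : ℝ) < (N : ℝ) ^ d := by positivity
  have h3 : (1 - 2 * H / (N : ℝ)) ^ d = ((N : ℝ) - 2 * H) ^ d / (N : ℝ) ^ d := by
    rw [← div_pow]
    congr 1
    field_simp
  rw [favg, favg, h3, card_cube, ← Finset.sum_sdiff hIsub]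
  push_cast
  rw [← div_self hNpos.ne', ← sub_div, ← add_div]
  refine div_le_div_of_nonneg_right ?_ hNpos.le
  linarith

/-- Cylinder sets in a power of `Bool` are clopen. -/
lemma isClopen_of_mem_measurableCylinders {ι : Type*} {s : Set (ι → Bool)}
    (hs : s ∈ measurableCylinders fun _ : ι => Bool) : IsClopen s := by
  obtain ⟨t, S, -, rfl⟩ := (mem_measurableCylinders s).1 hs
  exact (isClopen_discrete S).preimage (by fun_prop)

/-- **Unweighted Furstenberg correspondence principle.** Given `A n ⊆ [N n]^d` whose
upper density is at least `δ > 0`, there is a `ℤ^d`-system and a set `E` with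
`μ E ≥ δ` such that whenever `μ (T h₁ E ∩ … ∩ T hₖ E) > 0`, for a sequence of `n`
tending to infinity there exists `a ∈ [N n]^d` with `a + h₁, …, a + hₖ ∈ A n`. -/
theorem unweighted_furstenberg_correspondence
    (d : ℕ) (hd : 1 ≤ d) (N : ℕ → ℕ) (hN : Tendsto N atTop atTop)
    (A : ℕ → Finset (Fin d → ℤ)) (hA : ∀ n, A n ⊆ cube d (N n))
    (δ : ℝ) (hδ : 0 < δ)
    (hdens : δ ≤ atTop.limsup fun n =>
      favg (cube d (N n)) fun a => if a ∈ A n then (1 : ℝ) else 0) :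
    ∃ (X : Type) (_ : MeasurableSpace X) (μ : Measure X)
      (T : (Fin d → ℤ) → X → X) (E : Set X),
      IsProbabilityMeasure μ ∧
      (∀ h, MeasurePreserving (T h) μ μ) ∧
      (∀ h, Function.Bijective (T h)) ∧
      (∀ h h', T (h + h') = T h ∘ T h') ∧
      MeasurableSet E ∧ ENNReal.ofReal δ ≤ μ E ∧
      ∀ (k : ℕ) (h : Fin k → Fin d → ℤ),
        0 < μ (⋂ j, T (h j) '' E) →
        ∃ᶠ n in atTop, ∃ a ∈ cube d (N n), ∀ j, a + h j ∈ A n := by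
  classical
  set u : ℕ → ℝ := fun n => favg (cube d (N n)) fun a => if a ∈ A n then (1 : ℝ) else 0 with hu
  have hu0 : ∀ n, 0 ≤ u n := fun n => by
    simp only [hu, favg]
    positivity
  have hu1 : ∀ n, u n ≤ 1 := fun n => by
    refine div_le_one_of_le₀ ?_ (by positivity)
    calc _ ≤ ∑ a ∈ cube d (N n), (1 : ℝ) :=
          Finset.sum_le_sum fun a _ => by split_ifs <;> norm_num
      _ = _ := by simp
  have hcl : MapClusterPt (atTop.limsup u) atTop u :=
    MapClusterPt.limsup (isCoboundedUnder_le_of_le atTop hu0) (isBoundedUnder_of ⟨1, hu1⟩)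
  obtain ⟨U, hU, hUlim⟩ := mapClusterPt_iff_ultrafilter.1 hcl
  choose P hP using fun n =>
    exists_probabilityMeasure_eq_favg (cube d (N n)) (viewFrom (A n))
  obtain ⟨μ, hμ⟩ : ∃ μ, Tendsto P U (𝓝 μ) := by
    obtain ⟨μ, -, hμ⟩ := isCompact_univ.ultrafilter_le_nhds (U.map P) (by simp)
    exact ⟨μ, hμ⟩
  have hNpos : ∀ᶠ n in (U : Filter ℕ), 0 < N n := hU (hN.eventually_gt_atTop 0)
  have hlim : ∀ s : Set ((Fin d → ℤ) → Bool), IsClopen s →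
      Tendsto (fun n => favg (cube d (N n)) fun a => s.indicator 1 (viewFrom (A n) a)) U
        (𝓝 ((μ : Measure _).real s)) := by
    intro s hs
    have h1 := ProbabilityMeasure.tendsto_measure_of_isClopen_of_tendsto hμ hs
    have h2 : Tendsto (fun n => (P n : Measure _).real s) U (𝓝 ((μ : Measure _).real s)) :=
      (NNReal.tendsto_coe.2 h1)
    refine h2.congr' ?_
    filter_upwards [hNpos] with n hn
    refine hP n ?_ s hs.isOpen.measurableSet
    rw [← Finset.card_pos, card_cube]
    positivity
  have hle : ∀ h s, IsClopen s →
      (μ : Measure ((Fin d → ℤ) → Bool)).real (shift h ⁻¹' s) ≤ (μ : Measure _).real s := by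
    intro h s hs
    obtain ⟨H, hH⟩ : ∃ H : ℕ, ∀ i, |h i| ≤ H := by
      refine ⟨∑ i, (h i).natAbs, fun i => ?_⟩
      rw [Int.abs_eq_natAbs]
      exact_mod_cast Finset.single_le_sum (f := fun i => (h i).natAbs)
        (fun _ _ => Nat.zero_le _) (Finset.mem_univ i)
    have herr : Tendsto (fun n => 1 - (1 - 2 * H / (N n : ℝ)) ^ d) U (𝓝 0) := by
      have h0 : Tendsto (fun n => 2 * H / (N n : ℝ)) U (𝓝 0) :=
        (tendsto_const_nhds.div_atTop (tendsto_natCast_atTop_atTop.comp hN)).mono_left hU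
      simpa using ((h0.const_sub 1).pow d).const_sub 1
    have hR := (hlim s hs).add herr
    rw [add_zero] at hR
    refine le_of_tendsto_of_tendsto (hlim _ (hs.preimage (continuous_shift h))) hR ?_
    filter_upwards [hNpos, hU (hN.eventually_ge_atTop (2 * H))] with n hn hn'
    refine le_trans (le_of_eq ?_)
      (favg_cube_sub_le (N n) H h hH hn' hn (viewFrom (A n) ⁻¹' s))
    simp only [favg, Set.indicator, Set.mem_preimage, shift_viewFrom, Pi.one_apply]
  have hinv : ∀ h, MeasurePreserving (shift h) (μ : Measure ((Fin d → ℤ) → Bool)) μ := by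
    intro h
    have hm : Measurable (shift h) := (continuous_shift h).measurable
    refine ⟨hm, ?_⟩
    have : IsProbabilityMeasure ((μ : Measure ((Fin d → ℤ) → Bool)).map (shift h)) :=
      Measure.isProbabilityMeasure_map hm.aemeasurable
    refine ext_of_generate_finite _ generateFrom_measurableCylinders.symm
      isPiSystem_measurableCylinders (fun s hs => ?_) (by simp)
    have hc := isClopen_of_mem_measurableCylinders hs
    rw [Measure.map_apply hm hc.isOpen.measurableSet, ← measureReal_eq_measureReal_iff]
    refine le_antisymm (hle h s hc) ?_
    have := hle h sᶜ hc.compl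
    rw [Set.preimage_compl, probReal_compl_eq_one_sub hc.isOpen.measurableSet,
      probReal_compl_eq_one_sub (hm hc.isOpen.measurableSet)] at this
    linarith
  have hclopen : ∀ h : Fin d → ℤ, IsClopen {x : (Fin d → ℤ) → Bool | x h = true} := fun h =>
    (isClopen_discrete {true}).preimage (continuous_apply h)
  refine ⟨(Fin d → ℤ) → Bool, inferInstance, μ, shift, {x | x 0 = true}, inferInstance, hinv,
    shift_bijective, shift_add, (hclopen 0).isOpen.measurableSet, ?_, fun k h hpos => ?_⟩
  · rw [← ofReal_measureReal]
    refine ENNReal.ofReal_le_ofReal (hdens.trans_eq (tendsto_nhds_unique hUlim ?_))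
    refine (hlim _ (hclopen 0)).congr fun n => ?_
    simp [favg, u, viewFrom, Set.indicator]
  · simp only [image_shift] at hpos
    have hlim' := hlim _ (isClopen_iInter_of_finite fun j => hclopen (h j))
    have hpos' := ENNReal.toReal_pos hpos.ne' (measure_ne_top _ _)
    refine Frequently.filter_mono (Eventually.frequently ?_) hU
    filter_upwards [hlim'.eventually (lt_mem_nhds hpos')] with n hn
    by_contra! hcon
    refine hn.ne' ?_
    rw [favg, Finset.sum_eq_zero, zero_div]
    intro a ha
    obtain ⟨j, hj⟩ := hcon a ha
    refine Set.indicator_of_notMem (fun hmem => hj ?_) _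
    simpa [viewFrom] using Set.mem_iInter.1 hmem j
end
end
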